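/- arXiv:2201.08232 — 2 statements merged into one kernel-verified Lean document; each statement's English description precedes it below -/
import Mathlib

section
/- (Local Pohozaev identity.) Let f : Π × ℝ → ℝ be continuous and nondecreasing in its second argument, let F(x, u) := ∫₀ᵘ f(x, t) dt, and assume that for i ∈ {1, 2} the partial derivative ∂F/∂x_i exists and is continuous on Π × ℝ. Let u ∈ C¹(Π) with ∫_Π (|u|² + |∇u|²) dx < ∞ be a weak solution of −Δu = f(x, u) on Π, i.e. ∫_Π ∇u·∇φ dx = ∫_Π f(x, u) φ dx for every φ ∈ C_c^∞(Π). Then for every closed ball B̄_δ(z) ⊂ Π and each i ∈ {1, 2}: ∫_{∂B_δ(z)} (∂u/∂x_i)(∂u/∂ν) dσ − (1/2) ∫_{∂B_δ(z)} |∇u|² ν_i dσ + ∫_{∂B_δ(z)} F(x, u(x)) ν_i dσ = ∫_{B_δ(z)} (∂F/∂x_i)(x, u(x)) dx, where ν = (ν₁, ν₂) is the outward unit normal to the circle ∂B_δ(z), ∂u/∂ν = ∇u·ν, and dσ is the arc-length (1-dimensional Hausdorff) measure on ∂B_δ(z). -/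
open MeasureTheory Real Filter
open scoped RealInnerProductSpace

noncomputable section

/-- The plane `ℝ²` with the Euclidean norm. -/
abbrev Plane : Type := EuclideanSpace ℝ (Fin 2)

/-- The point `(a, b)` of the plane. -/
def mk2 (a b : ℝ) : Plane := (WithLp.equiv 2 (Fin 2 → ℝ)).symm ![a, b]

/-- The open right half plane `Π = {x : x₁ > 0}`. -/
def halfPlane : Set Plane := {x : Plane | 0 < x 0}

/-- The reflection `x̄ = (−x₁, x₂)` of a point `x = (x₁, x₂)`. -/
def reflPt (x : Plane) : Plane := mk2 (-(x 0)) (x 1)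

/-- The Green function `G_*` on the half plane of the operator `−(1/x₁)div((1/x₁)∇)`. -/
def Gstar (x x' : Plane) : ℝ :=
  x 0 * (x' 0) ^ 2 / (4 * π) *
    ∫ θ in (-π)..π, Real.cos θ /
      Real.sqrt ((x 1 - x' 1) ^ 2 + (x 0) ^ 2 + (x' 0) ^ 2 - 2 * x 0 * x' 0 * Real.cos θ)

/-- The Green function of `−Δ` on the half plane. -/
def Gfun (x x' : Plane) : ℝ :=
  (1 / (4 * π)) * Real.log
    (((x 0 + x' 0) ^ 2 + (x 1 - x' 1) ^ 2) / ((x 0 - x' 0) ^ 2 + (x 1 - x' 1) ^ 2))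

/-- The regular part `H_c(x,x') = G_*(x,x') − c² G(x,x')`. -/
def Hker (c : ℝ) (x x' : Plane) : ℝ := Gstar x x' - c ^ 2 * Gfun x x'

/-- The regular part `H_c`, extended continuously to the diagonal. -/
def HkerExt (c : ℝ) (x x' : Plane) : ℝ := by
  classical
  exact if x = x' then limUnder (nhdsWithin x' {x'}ᶜ) (fun y => Hker c y x')
    else Hker c x x'

/-- The cross-section `A = {x ∈ Π : ψ(x) − (W/2) x₁² ln(1/ε) > μ}`. -/
def crossSection (ψ : Plane → ℝ) (ε W μ : ℝ) : Set Plane :=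
  {x : Plane | x ∈ halfPlane ∧ μ < ψ x - W / 2 * (x 0) ^ 2 * Real.log (1 / ε)}

/-- `ψ` is a stream function of a steady vortex ring with parameters `(ε, W, μ)`. -/
structure IsVortexRingStream (ψ : Plane → ℝ) (ε W μ : ℝ) : Prop where
  continuousOn : ContinuousOn ψ halfPlane
  bounded : Bornology.IsBounded (crossSection ψ ε W μ)
  closure_subset : closure (crossSection ψ ε W μ) ⊆ halfPlane
  repr : ∀ x ∈ halfPlane, ψ x = (∫ x' in crossSection ψ ε W μ, Gstar x x') / ε ^ 2

/-- The circulation `ε⁻² ∫_A x₁ dx` of a vortex ring. -/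
def circulation (ψ : Plane → ℝ) (ε W μ : ℝ) : ℝ :=
  (∫ x in crossSection ψ ε W μ, x 0) / ε ^ 2

/-- `ψ` is centralized: it is even in the second variable. -/
def Centralized (ψ : Plane → ℝ) : Prop :=
  ∀ a b : ℝ, ψ (mk2 a (-b)) = ψ (mk2 a b)

section Auxiliary

open Set Topology
open scoped NNReal ENNReal Convolution

/-- The point of the plane whose `i`-th coordinate is `a` and whose other coordinate is `b`. -/
def coordPt (i : Fin 2) (a b : ℝ) : Plane := WithLp.toLp 2 fun k => if k = i then a else b

lemma coordPt_norm_sq (i : Fin 2) (a b : ℝ) : ‖coordPt i a b‖ ^ 2 = a ^ 2 + b ^ 2 := by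
  rw [EuclideanSpace.norm_sq_eq]
  fin_cases i <;> simp [coordPt, add_comm]

lemma coordPt_sub (i : Fin 2) (a b c d : ℝ) :
    coordPt i a b - coordPt i c d = coordPt i (a - c) (b - d) := by
  ext k
  by_cases h : k = i <;> simp [coordPt, h]

lemma exists_eq_coordPt (i : Fin 2) (x : Plane) : ∃ a b, x = coordPt i a b := by
  refine ⟨x i, x (1 - i), ?_⟩
  ext k
  fin_cases i <;> fin_cases k <;> simp [coordPt]

lemma continuous_coordPt (i : Fin 2) : Continuous fun p : ℝ × ℝ => coordPt i p.1 p.2 := by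
  unfold coordPt
  refine (PiLp.continuous_toLp 2 _).comp (continuous_pi fun k => ?_)
  by_cases h : k = i <;> simp only [h, if_true, if_false] <;> fun_prop

/-- The parametrisation of the circle `∂B_δ(z)` by the angle measured from the `i`-th axis. -/
def circlePt (i : Fin 2) (z : Plane) (δ θ : ℝ) : Plane :=
  z + coordPt i (δ * cos θ) (δ * sin θ)

lemma continuous_circlePt (i : Fin 2) (z : Plane) (δ : ℝ) : Continuous (circlePt i z δ) :=
  continuous_const.add ((continuous_coordPt i).comp
    (by fun_prop : Continuous fun θ : ℝ => (δ * cos θ, δ * sin θ)))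

lemma circlePt_mem_sphere (i : Fin 2) (z : Plane) {δ : ℝ} (hδ : 0 ≤ δ) (θ : ℝ) :
    circlePt i z δ θ ∈ Metric.sphere z δ := by
  rw [mem_sphere_iff_norm, circlePt, add_sub_cancel_left]
  have h := coordPt_norm_sq i (δ * cos θ) (δ * sin θ)
  have h2 : ‖coordPt i (δ * cos θ) (δ * sin θ)‖ ^ 2 = δ ^ 2 := by
    rw [h]; nlinarith [sin_sq_add_cos_sq θ]
  exact (pow_left_inj₀ (norm_nonneg _) hδ two_ne_zero).1 h2

lemma dist_circlePt (i : Fin 2) (z : Plane) {δ : ℝ} (hδ : 0 ≤ δ) (s t : ℝ) :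
    dist (circlePt i z δ s) (circlePt i z δ t) = 2 * δ * |sin ((s - t) / 2)| := by
  rw [circlePt, circlePt, dist_add_left, dist_eq_norm, coordPt_sub]
  refine (pow_left_inj₀ (norm_nonneg _) (by positivity) two_ne_zero).1 ?_
  rw [coordPt_norm_sq, mul_pow, sq_abs]
  have h := cos_sq ((s - t) / 2)
  rw [mul_div_cancel₀ _ (two_ne_zero' ℝ)] at h
  have h1 := sin_sq_add_cos_sq ((s - t) / 2)
  rw [cos_sub] at h
  have hs := sin_sq_add_cos_sq s
  have ht := sin_sq_add_cos_sq t
  linear_combination δ ^ 2 * hs + δ ^ 2 * ht - 4 * δ ^ 2 * h1 + 4 * δ ^ 2 * h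

lemma circlePt_injOn (i : Fin 2) (z : Plane) {δ : ℝ} (hδ : 0 < δ) (a : ℝ) :
    InjOn (circlePt i z δ) (Ioc a (a + 2 * π)) := by
  intro s hs t ht h
  have h0 := dist_circlePt i z hδ.le s t
  rw [h, dist_self] at h0
  have h1 : sin ((s - t) / 2) = 0 := by
    have : |sin ((s - t) / 2)| = 0 := by
      rcases mul_eq_zero.1 h0.symm with h' | h'
      · linarith
      · exact h'
    exact abs_eq_zero.1 this
  have := (sin_eq_zero_iff_of_lt_of_lt (by linarith [hs.1, ht.2]) (by linarith [hs.2, ht.1])).1 h1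
  linarith

lemma circlePt_image (i : Fin 2) (z : Plane) {δ : ℝ} (hδ : 0 < δ) (a : ℝ) :
    circlePt i z δ '' Ioc a (a + 2 * π) = Metric.sphere z δ := by
  refine Subset.antisymm (image_subset_iff.2 fun θ _ => circlePt_mem_sphere i z hδ.le θ) ?_
  intro x hx
  obtain ⟨c, d, hcd⟩ := exists_eq_coordPt i (x - z)
  have hn : c ^ 2 + d ^ 2 = δ ^ 2 := by
    rw [← coordPt_norm_sq i, ← hcd, mem_sphere_iff_norm.1 hx]
  set w : ℂ := ⟨c, d⟩ with hw
  have hwn : ‖w‖ = δ := by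
    refine (pow_left_inj₀ (norm_nonneg _) hδ.le two_ne_zero).1 ?_
    rw [Complex.sq_norm, Complex.normSq_mk, ← hn]; ring
  have hc : δ * cos w.arg = c := by rw [← hwn]; exact Complex.norm_mul_cos_arg w
  have hd : δ * sin w.arg = d := by rw [← hwn]; exact Complex.norm_mul_sin_arg w
  refine ⟨toIocMod two_pi_pos a w.arg, toIocMod_mem_Ioc _ _ _, ?_⟩
  rw [circlePt, toIocMod, zsmul_eq_mul, cos_sub_int_mul_two_pi, sin_sub_int_mul_two_pi, hc, hd,
    ← hcd]
  abel

lemma lipschitzWith_circlePt (i : Fin 2) (z : Plane) {δ : ℝ} (hδ : 0 ≤ δ) :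
    LipschitzWith (Real.toNNReal δ) (circlePt i z δ) := by
  refine LipschitzWith.of_dist_le_mul fun s t => ?_
  rw [dist_circlePt i z hδ, Real.coe_toNNReal _ hδ, Real.dist_eq]
  have h : |sin ((s - t) / 2)| ≤ |(s - t) / 2| := abs_sin_le_abs
  rw [abs_div, abs_two] at h
  nlinarith

lemma one_sub_mul_dist_le_dist_circlePt (i : Fin 2) (z : Plane) {δ : ℝ} (hδ : 0 ≤ δ) {η s t : ℝ}
    (hη : 0 ≤ η) (hη1 : η ≤ 1) (hst : |s - t| ≤ η) :
    δ * (1 - η) * dist s t ≤ dist (circlePt i z δ s) (circlePt i z δ t) := by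
  rw [dist_circlePt i z hδ, Real.dist_eq]
  have key : (1 - η) * |s - t| ≤ 2 * |sin ((s - t) / 2)| := by
    rcases eq_or_ne s t with rfl | hne
    · simp
    have hpos : 0 < |s - t| / 2 := by have := abs_pos.2 (sub_ne_zero.2 hne); positivity
    have h1 := sin_gt_sub_cube hpos
    have h2 : sin (|s - t| / 2) ≤ |sin ((s - t) / 2)| := by
      rcases abs_cases (s - t) with ⟨h, _⟩ | ⟨h, _⟩
      · rw [h]; exact le_abs_self _
      · rw [h, neg_div, sin_neg]; exact neg_le_abs _
    have h3 : (|s - t| / 2) ^ 3 ≤ η * (|s - t| / 2) := by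
      have : (|s - t| / 2) ^ 2 ≤ η := by nlinarith
      nlinarith
    nlinarith
  nlinarith

lemma hausdorffMeasure_circlePt_image_of_subset (i : Fin 2) (z : Plane) {δ : ℝ} (hδ : 0 < δ)
    {η : ℝ} (hη : 0 < η) (hη1 : η < 1) {A : Set ℝ} {c : ℝ} (hA : A ⊆ Ico c (c + η)) :
    ENNReal.ofReal (δ * (1 - η)) * volume A ≤ μH[1] (circlePt i z δ '' A) := by
  set g := Function.invFunOn (circlePt i z δ) A
  have hpos : 0 < δ * (1 - η) := mul_pos hδ (by linarith)
  have hle : ∀ s ∈ A, ∀ t ∈ A,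
      δ * (1 - η) * dist s t ≤ dist (circlePt i z δ s) (circlePt i z δ t) := fun s hs t ht =>
    one_sub_mul_dist_le_dist_circlePt i z hδ.le hη.le hη1.le
      (abs_le.2 ⟨by linarith [(hA hs).1, (hA ht).2], by linarith [(hA hs).2, (hA ht).1]⟩)
  have hinj : InjOn (circlePt i z δ) A := fun s hs t ht h => by
    have := hle s hs t ht
    rw [h, dist_self] at this
    exact dist_le_zero.1 (nonpos_of_mul_nonpos_right this hpos)
  have hg : ∀ s ∈ A, g (circlePt i z δ s) = s := fun s hs => hinj.leftInvOn_invFunOn hs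
  have hlip : LipschitzOnWith (Real.toNNReal (δ * (1 - η))⁻¹) g (circlePt i z δ '' A) := by
    refine LipschitzOnWith.of_dist_le_mul ?_
    rintro _ ⟨s, hs, rfl⟩ _ ⟨t, ht, rfl⟩
    rw [hg s hs, hg t ht, Real.coe_toNNReal _ (inv_nonneg.2 hpos.le), inv_mul_eq_div,
      le_div_iff₀ hpos, mul_comm]
    exact hle s hs t ht
  have h := hlip.hausdorffMeasure_image_le zero_le_one
  have him : g '' (circlePt i z δ '' A) = A := by
    rw [image_image]
    exact (image_congr hg).trans (image_id' A)
  rw [him, hausdorffMeasure_real, ENNReal.rpow_one] at h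
  calc ENNReal.ofReal (δ * (1 - η)) * volume A
      ≤ ENNReal.ofReal (δ * (1 - η)) * (ENNReal.ofReal (δ * (1 - η))⁻¹ *
          μH[1] (circlePt i z δ '' A)) := by gcongr; exact h
    _ = μH[1] (circlePt i z δ '' A) := by
      rw [← mul_assoc, ← ENNReal.ofReal_mul hpos.le, mul_inv_cancel₀ hpos.ne', ENNReal.ofReal_one,
        one_mul]

/-- Hausdorff measure on a circle is arc length. -/
lemma hausdorffMeasure_circlePt_image (i : Fin 2) (z : Plane) {δ : ℝ} (hδ : 0 < δ) {a : ℝ}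
    {A : Set ℝ} (hA : A ⊆ Ioc a (a + 2 * π)) (hAm : MeasurableSet A) :
    μH[1] (circlePt i z δ '' A) = ENNReal.ofReal δ * volume A := by
  refine le_antisymm ?_ ?_
  · have h := (lipschitzWith_circlePt i z hδ.le).hausdorffMeasure_image_le zero_le_one A
    rwa [hausdorffMeasure_real, ENNReal.rpow_one] at h
  have hlow : ∀ η : ℝ, 0 < η → η < 1 →
      ENNReal.ofReal (δ * (1 - η)) * volume A ≤ μH[1] (circlePt i z δ '' A) := by
    intro η hη hη1
    let S : ℤ → Set ℝ := fun n => A ∩ Ico (n • η) ((n + 1) • η)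
    have hS : ⋃ n, S n = A := by
      rw [← inter_iUnion, iUnion_Ico_zsmul hη, inter_univ]
    have hSm : ∀ n, MeasurableSet (S n) := fun n => hAm.inter measurableSet_Ico
    have hSd : Pairwise (Function.onFun Disjoint S) := fun m n hmn =>
      (pairwise_disjoint_Ico_zsmul η hmn).mono inter_subset_right inter_subset_right
    have hinj := (circlePt_injOn i z hδ a).mono hA
    have him : circlePt i z δ '' A = ⋃ n, circlePt i z δ '' S n := by
      rw [← image_iUnion, hS]
    rw [him, measure_iUnion]
    · conv_lhs => rw [← hS, measure_iUnion hSd hSm, ← ENNReal.tsum_mul_left]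
      refine ENNReal.tsum_le_tsum fun n => ?_
      refine hausdorffMeasure_circlePt_image_of_subset i z hδ hη hη1 (c := n • η) ?_
      intro x hx
      have := hx.2
      rwa [add_smul, one_smul] at this
    · intro m n hmn
      exact disjoint_image_image fun x hx y hy hxy => by
        have := hinj hx.1 hy.1 hxy
        subst this
        exact (hSd hmn).le_bot ⟨hx, hy⟩
    · intro n
      exact (hSm n).image_of_continuousOn_injOn (continuous_circlePt i z δ).continuousOn
        (hinj.mono inter_subset_left)
  have hlim : Tendsto (fun η : ℝ => ENNReal.ofReal (δ * (1 - η)) * volume A) (𝓝[>] 0)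
      (𝓝 (ENNReal.ofReal δ * volume A)) := by
    have hfin : volume A ≠ ∞ := measure_ne_top_of_subset hA measure_Ioc_lt_top.ne
    refine ENNReal.Tendsto.mul_const ?_ (Or.inr hfin)
    have : Tendsto (fun η : ℝ => δ * (1 - η)) (𝓝[>] 0) (𝓝 (δ * (1 - 0))) :=
      ((by fun_prop : Continuous fun η : ℝ => δ * (1 - η)).tendsto 0).mono_left nhdsWithin_le_nhds
    rw [sub_zero, mul_one] at this
    exact ENNReal.tendsto_ofReal this
  refine le_of_tendsto hlim ?_
  filter_upwards [Ioo_mem_nhdsGT (zero_lt_one' ℝ)] with η hη using hlow η hη.1 hη.2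

lemma hausdorffMeasure_restrict_sphere (i : Fin 2) (z : Plane) {δ : ℝ} (hδ : 0 < δ) (a : ℝ) :
    (μH[1] : Measure Plane).restrict (Metric.sphere z δ) =
      ENNReal.ofReal δ • (volume.restrict (Ioc a (a + 2 * π))).map (circlePt i z δ) := by
  have hm := (continuous_circlePt i z δ).measurable
  ext B hB
  rw [Measure.restrict_apply hB, Measure.smul_apply, Measure.map_apply hm hB,
    Measure.restrict_apply (hm hB), smul_eq_mul,
    ← hausdorffMeasure_circlePt_image i z hδ inter_subset_right ((hm hB).inter measurableSet_Ioc),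
    inter_comm (circlePt i z δ ⁻¹' B), image_inter_preimage, circlePt_image i z hδ, inter_comm]

lemma isFiniteMeasure_restrict_sphere (z : Plane) {δ : ℝ} (hδ : 0 < δ) :
    IsFiniteMeasure ((μH[1] : Measure Plane).restrict (Metric.sphere z δ)) := by
  rw [hausdorffMeasure_restrict_sphere 0 z hδ 0]
  have : IsFiniteMeasure ((volume.restrict (Ioc 0 (0 + 2 * π))).map (circlePt 0 z δ)) :=
    inferInstance
  exact Measure.smul_finite _ ENNReal.ofReal_ne_top

lemma setIntegral_sphere (i : Fin 2) (z : Plane) {δ : ℝ} (hδ : 0 < δ) (a : ℝ) {g : Plane → ℝ}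
    (hg : ContinuousOn g (Metric.sphere z δ)) :
    ∫ x in Metric.sphere z δ, g x ∂μH[1] =
      ∫ θ in a..a + 2 * π, δ * g (circlePt i z δ θ) := by
  have hmeas := hg.aestronglyMeasurable (μ := μH[1]) Metric.isClosed_sphere.measurableSet
  rw [hausdorffMeasure_restrict_sphere i z hδ a] at hmeas ⊢
  have hmeas' : AEStronglyMeasurable g
      ((volume.restrict (Ioc a (a + 2 * π))).map (circlePt i z δ)) := by
    refine hmeas.mono_ac (Measure.absolutelyContinuous_smul ?_)
    simpa using hδ
  rw [integral_smul_measure, integral_map (continuous_circlePt i z δ).aemeasurable hmeas',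
    intervalIntegral.integral_of_le (by linarith [pi_pos]), ENNReal.toReal_ofReal hδ.le,
    smul_eq_mul, ← integral_const_mul]

lemma coordPt_injective (i : Fin 2) :
    Function.Injective fun p : ℝ × ℝ => coordPt i p.2 p.1 := by
  intro p q h
  have h0 := congrArg (fun x : Plane => ‖x - coordPt i q.2 q.1‖ ^ 2) h
  simp only [coordPt_sub, coordPt_norm_sq] at h0
  exact Prod.ext (by nlinarith [sq_nonneg (p.1 - q.1), sq_nonneg (p.2 - q.2)])
    (by nlinarith [sq_nonneg (p.1 - q.1), sq_nonneg (p.2 - q.2)])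

lemma measurePreserving_coordPt (i : Fin 2) :
    MeasurePreserving fun p : ℝ × ℝ => coordPt i p.2 p.1 := by
  have h := (PiLp.volume_preserving_toLp (Fin 2)).comp (volume_preserving_finTwoArrow ℝ).symm
  fin_cases i
  · have he : (fun p : ℝ × ℝ => coordPt 0 p.2 p.1) =
        (WithLp.toLp 2 ∘ MeasurableEquiv.finTwoArrow.symm) ∘ Prod.swap := by
      funext p
      ext k
      fin_cases k <;> simp [coordPt]
    exact he ▸ h.comp (Measure.measurePreserving_swap (μ := volume) (ν := volume))
  · have he : (fun p : ℝ × ℝ => coordPt 1 p.2 p.1) =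
        WithLp.toLp 2 ∘ MeasurableEquiv.finTwoArrow.symm := by
      funext p
      ext k
      fin_cases k <;> simp [coordPt]
    exact he ▸ h

lemma add_coordPt_mem_ball {i : Fin 2} {z : Plane} {δ : ℝ} (hδ : 0 < δ) {a b : ℝ} :
    z + coordPt i a b ∈ Metric.ball z δ ↔ a ^ 2 + b ^ 2 < δ ^ 2 := by
  rw [mem_ball_iff_norm, add_sub_cancel_left, ← coordPt_norm_sq i]
  exact (pow_lt_pow_iff_left₀ (norm_nonneg _) hδ.le two_ne_zero).symm

lemma add_coordPt_mem_closedBall {i : Fin 2} {z : Plane} {δ : ℝ} (hδ : 0 < δ) {a b : ℝ} :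
    z + coordPt i a b ∈ Metric.closedBall z δ ↔ a ^ 2 + b ^ 2 ≤ δ ^ 2 := by
  rw [mem_closedBall_iff_norm, add_sub_cancel_left, ← coordPt_norm_sq i]
  exact (pow_le_pow_iff_left₀ (norm_nonneg _) hδ.le two_ne_zero).symm

lemma setIntegral_ball (i : Fin 2) (z : Plane) {δ : ℝ} (hδ : 0 < δ) {g : Plane → ℝ}
    (hg : IntegrableOn g (Metric.ball z δ)) :
    ∫ x in Metric.ball z δ, g x =
      ∫ b in (-δ)..δ, ∫ a in (-√(δ ^ 2 - b ^ 2))..√(δ ^ 2 - b ^ 2), g (z + coordPt i a b) := by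
  have hT : MeasurePreserving fun p : ℝ × ℝ => z + coordPt i p.2 p.1 :=
    (measurePreserving_add_left volume z).comp (measurePreserving_coordPt i)
  have hE : MeasurableEmbedding fun p : ℝ × ℝ => z + coordPt i p.2 p.1 :=
    (measurableEmbedding_addLeft z).comp
      (((continuous_coordPt i).comp continuous_swap).measurableEmbedding (coordPt_injective i))
  rw [← integral_indicator measurableSet_ball, ← hT.integral_comp hE]
  have hint := (hT.integrable_comp_emb hE).2 ((integrable_indicator_iff measurableSet_ball).2 hg)
  rw [Measure.volume_eq_prod] at hint ⊢
  refine (integral_prod _ hint).trans ?_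
  rw [intervalIntegral.integral_of_le (by linarith),
    integral_Ioc_eq_integral_Ioo, ← integral_indicator measurableSet_Ioo]
  congr 1
  funext b
  by_cases hb : b ∈ Ioo (-δ) δ
  · rw [indicator_of_mem hb,
      intervalIntegral.integral_of_le (by linarith [sqrt_nonneg (δ ^ 2 - b ^ 2)]),
      integral_Ioc_eq_integral_Ioo, ← integral_indicator measurableSet_Ioo]
    congr 1
    funext a
    have : z + coordPt i a b ∈ Metric.ball z δ ↔ a ∈ Ioo (-√(δ ^ 2 - b ^ 2)) √(δ ^ 2 - b ^ 2) := by
      rw [add_coordPt_mem_ball hδ, mem_Ioo, ← Real.sq_lt]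
      constructor <;> intro h <;> linarith
    by_cases ha : a ∈ Ioo (-√(δ ^ 2 - b ^ 2)) √(δ ^ 2 - b ^ 2)
    · rw [indicator_of_mem ha, Function.comp_apply, indicator_of_mem (this.2 ha)]
    · rw [indicator_of_notMem ha, Function.comp_apply, indicator_of_notMem (mt this.1 ha)]
  · rw [indicator_of_notMem hb]
    refine integral_eq_zero_of_ae (Eventually.of_forall fun a => ?_)
    refine indicator_of_notMem (fun h => hb ?_) _
    exact abs_lt.1 (abs_lt_of_sq_lt_sq
      (by nlinarith [(add_coordPt_mem_ball hδ).1 h, sq_nonneg a]) hδ.le)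

lemma single_smul_add_coordPt (i : Fin 2) (z : Plane) (a b t : ℝ) :
    z + coordPt i a b + t • EuclideanSpace.single i 1 = z + coordPt i (a + t) b := by
  ext k
  by_cases h : k = i <;> simp [coordPt, h, add_assoc]

lemma hasDerivAt_comp_coordPt {i : Fin 2} {z : Plane} {a b g' : ℝ} {G : Plane → ℝ}
    (h : HasLineDerivAt ℝ G g' (z + coordPt i a b) (EuclideanSpace.single i 1)) :
    HasDerivAt (fun a => G (z + coordPt i a b)) g' a := by
  have h1 : HasDerivAt (fun t => G (z + coordPt i (a + t) b)) g' (a - a) := by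
    rw [sub_self]
    simpa only [HasLineDerivAt, single_smul_add_coordPt] using h
  simpa using h1.comp_sub_const a a

/-- The divergence theorem on a disc for a field parallel to a coordinate axis. -/
theorem integral_sphere_mul_normal_eq_integral_ball (i : Fin 2) (z : Plane) {δ : ℝ} (hδ : 0 < δ)
    {G g : Plane → ℝ} (hG : ContinuousOn G (Metric.closedBall z δ))
    (hg : ContinuousOn g (Metric.closedBall z δ))
    (hGg : ∀ x ∈ Metric.ball z δ, HasLineDerivAt ℝ G (g x) x (EuclideanSpace.single i 1)) :
    ∫ x in Metric.sphere z δ, G x * ((x i - z i) / δ) ∂μH[1] = ∫ x in Metric.ball z δ, g x := by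
  have hcoord : Continuous fun p : ℝ × ℝ => z + coordPt i p.1 p.2 :=
    continuous_const.add (continuous_coordPt i)
  have hslice : ∀ b ∈ Icc (-δ) δ,
      ∫ a in (-√(δ ^ 2 - b ^ 2))..√(δ ^ 2 - b ^ 2), g (z + coordPt i a b) =
        G (z + coordPt i √(δ ^ 2 - b ^ 2) b) - G (z + coordPt i (-√(δ ^ 2 - b ^ 2)) b) := by
    intro b hb
    have hb2 : 0 ≤ δ ^ 2 - b ^ 2 := by nlinarith [hb.1, hb.2]
    have hle : -√(δ ^ 2 - b ^ 2) ≤ √(δ ^ 2 - b ^ 2) := by linarith [sqrt_nonneg (δ ^ 2 - b ^ 2)]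
    have hmaps : MapsTo (fun a => z + coordPt i a b) (Icc (-√(δ ^ 2 - b ^ 2)) √(δ ^ 2 - b ^ 2))
        (Metric.closedBall z δ) := fun a ha => by
      rw [add_coordPt_mem_closedBall hδ]
      have := (Real.sq_le hb2).2 ha
      linarith
    have hc : Continuous fun a => z + coordPt i a b :=
      hcoord.comp (by fun_prop : Continuous fun a : ℝ => (a, b))
    refine intervalIntegral.integral_eq_sub_of_hasDerivAt_of_le hle
      (hG.comp hc.continuousOn hmaps) (fun a ha => hasDerivAt_comp_coordPt (hGg _ ?_)) ?_
    · rw [add_coordPt_mem_ball hδ]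
      have := Real.sq_lt.2 ha
      linarith
    · refine ContinuousOn.intervalIntegrable ?_
      rw [uIcc_of_le hle]
      exact hg.comp hc.continuousOn hmaps
  set D : ℝ → ℝ := fun b =>
    G (z + coordPt i √(δ ^ 2 - b ^ 2) b) - G (z + coordPt i (-√(δ ^ 2 - b ^ 2)) b) with hD
  have hGs : ContinuousOn G (Metric.sphere z δ) := hG.mono Metric.sphere_subset_closedBall
  have hDc : ContinuousOn D (Icc (-δ) δ) := by
    have hmem : ∀ b ∈ Icc (-δ) δ, √(δ ^ 2 - b ^ 2) ^ 2 + b ^ 2 ≤ δ ^ 2 := fun b hb => by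
      rw [sq_sqrt (by nlinarith [hb.1, hb.2])]; linarith
    refine (hG.comp (hcoord.comp (by fun_prop : Continuous fun b : ℝ =>
      (√(δ ^ 2 - b ^ 2), b))).continuousOn fun b hb => ?_).sub
      (hG.comp (hcoord.comp (by fun_prop : Continuous fun b : ℝ =>
      (-√(δ ^ 2 - b ^ 2), b))).continuousOn fun b hb => ?_)
    · exact (add_coordPt_mem_closedBall hδ).2 (hmem b hb)
    · exact (add_coordPt_mem_closedBall hδ).2 (by rw [neg_sq]; exact hmem b hb)
  have hsin : ∀ θ : ℝ, δ * sin θ ∈ Icc (-δ) δ := fun θ =>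
    ⟨by nlinarith [neg_one_le_sin θ], by nlinarith [sin_le_one θ]⟩
  have hRHS : ∫ x in Metric.ball z δ, g x =
      ∫ θ in (-(π / 2))..(π / 2), D (δ * sin θ) * (δ * cos θ) := by
    have hgi : IntegrableOn g (Metric.ball z δ) :=
      (hg.integrableOn_compact (isCompact_closedBall z δ)).mono_set Metric.ball_subset_closedBall
    rw [setIntegral_ball i z hδ hgi]
    have h := intervalIntegral.integral_comp_mul_deriv'' (a := -(π / 2)) (b := π / 2)
      (f := fun θ => δ * sin θ) (f' := fun θ => δ * cos θ) (g := D) (by fun_prop)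
      (fun θ _ => ((hasDerivAt_sin θ).const_mul δ).hasDerivWithinAt) (by fun_prop)
      (hDc.mono (image_subset_iff.2 fun θ _ => hsin θ))
    simp only [sin_neg, sin_pi_div_two, mul_neg, mul_one, Function.comp_def] at h
    rw [h]
    refine intervalIntegral.integral_congr fun b hb => ?_
    rw [uIcc_of_le (by linarith)] at hb
    exact hslice b hb
  rw [hRHS, setIntegral_sphere i z hδ (-(π / 2))
    (g := fun x => G x * ((x i - z i) / δ)) (hGs.mul (by fun_prop))]
  have hcirc : ∀ θ, δ * (G (circlePt i z δ θ) * ((circlePt i z δ θ i - z i) / δ)) =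
      G (circlePt i z δ θ) * (δ * cos θ) := fun θ => by
    have : circlePt i z δ θ i - z i = δ * cos θ := by simp [circlePt, coordPt]
    rw [this]; field_simp
  simp only [hcirc]
  have hcont : Continuous fun θ => G (circlePt i z δ θ) * (δ * cos θ) :=
    (hGs.comp_continuous (continuous_circlePt i z δ) (circlePt_mem_sphere i z hδ.le)).mul
      (by fun_prop)
  rw [← intervalIntegral.integral_add_adjacent_intervals (b := π / 2)
    (hcont.intervalIntegrable _ _) (hcont.intervalIntegrable _ _)]
  have hrefl : ∫ θ in (π / 2)..(-(π / 2) + 2 * π), G (circlePt i z δ θ) * (δ * cos θ) =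
      ∫ θ in (-(π / 2))..(π / 2), G (circlePt i z δ (π - θ)) * (δ * cos (π - θ)) := by
    rw [intervalIntegral.integral_comp_sub_left
      (fun θ => G (circlePt i z δ θ) * (δ * cos θ)) π]
    congr 1 <;> ring
  have hcont' : Continuous fun θ => G (circlePt i z δ (π - θ)) * (δ * cos (π - θ)) :=
    hcont.comp (by fun_prop : Continuous fun θ : ℝ => π - θ)
  rw [hrefl, ← intervalIntegral.integral_add (hcont.intervalIntegrable _ _)
    (hcont'.intervalIntegrable _ _)]
  refine intervalIntegral.integral_congr fun θ hθ => ?_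
  rw [uIcc_of_le (by linarith [pi_pos])] at hθ
  have hsq : √(δ ^ 2 - (δ * sin θ) ^ 2) = δ * cos θ := by
    rw [← sqrt_sq (mul_nonneg hδ.le (cos_nonneg_of_mem_Icc hθ))]
    congr 1
    linear_combination -δ ^ 2 * sin_sq_add_cos_sq θ
  simp only [hD, hsq, circlePt, cos_pi_sub, sin_pi_sub, mul_neg]
  ring

lemma isOpen_halfPlane : IsOpen halfPlane :=
  isOpen_lt continuous_const (by fun_prop : Continuous fun x : Plane => x 0)

lemma hasDerivAt_sub_comp {φ p : ℝ → ℝ → ℝ} {w : ℝ → ℝ} (hw : ContinuousAt w 0)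
    (hp : ContinuousAt (Function.uncurry p) (0, w 0))
    (h : ∀ᶠ t in 𝓝 (0 : ℝ), ∀ v, HasDerivAt (fun s => φ s v) (p t v) t) :
    HasDerivAt (fun t => φ t (w t) - φ 0 (w t)) (p 0 (w 0)) 0 := by
  rw [hasDerivAt_iff_isLittleO_nhds_zero, Asymptotics.isLittleO_iff]
  intro ε hε
  have h1 : ∀ᶠ q in 𝓝 ((0 : ℝ), w 0), dist (p q.1 q.2) (p 0 (w 0)) < ε :=
    Metric.tendsto_nhds.1 hp ε hε
  rw [nhds_prod_eq] at h1
  obtain ⟨pa, ha, pb, hb, hab⟩ := eventually_prod_iff.1 h1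
  obtain ⟨r, hr, hball⟩ := Metric.eventually_nhds_iff_ball.1 (ha.and h)
  filter_upwards [hw.eventually hb, Metric.ball_mem_nhds 0 hr] with t ht htr
  have hseg : segment ℝ 0 t ⊆ Metric.ball 0 r :=
    (convex_ball _ _).segment_subset (Metric.mem_ball_self hr) htr
  have hmv := (convex_segment (𝕜 := ℝ) 0 t).norm_image_sub_le_of_norm_hasDerivWithin_le
    (f := fun s => φ s (w t) - s * p 0 (w 0)) (f' := fun s => p s (w t) - 1 * p 0 (w 0)) (C := ε)
    (fun s hs => (((hball s (hseg hs)).2 (w t)).sub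
      ((hasDerivAt_id s).mul_const _)).hasDerivWithinAt)
    (fun s hs => by
      have := hab (hball s (hseg hs)).1 ht
      rw [Real.dist_eq] at this
      rw [one_mul]
      exact this.le)
    (left_mem_segment ℝ 0 t) (right_mem_segment ℝ 0 t)
  convert hmv using 2
  · simp; ring
  · simp

lemma continuousOn_primitive_comp {f : Plane → ℝ → ℝ} {s : Set Plane}
    (hf : ContinuousOn (fun q : Plane × ℝ => f q.1 q.2) (s ×ˢ Set.univ))
    {u : Plane → ℝ} (hu : ContinuousOn u s) :
    ContinuousOn (fun x => ∫ t in (0 : ℝ)..(u x), f x t) s := by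
  rw [continuousOn_iff_continuous_domRestrict] at hu ⊢
  refine intervalIntegral.continuous_parametric_intervalIntegral_of_continuous
    (f := fun (x : s) t => f x t) ?_ hu
  exact hf.comp_continuous (f := fun q : s × ℝ => ((q.1 : Plane), q.2)) (by fun_prop)
    fun q => ⟨q.1.2, mem_univ _⟩

lemma hasLineDerivAt_primitive_comp {f Fi : Plane → ℝ → ℝ} {s : Set Plane} (hs : IsOpen s)
    (hf : ContinuousOn (fun q : Plane × ℝ => f q.1 q.2) (s ×ˢ Set.univ))
    {e : Plane} (hFi_cont : ContinuousOn (fun q : Plane × ℝ => Fi q.1 q.2) (s ×ˢ Set.univ))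
    (hFi : ∀ x ∈ s, ∀ v : ℝ,
      HasDerivAt (fun t : ℝ => ∫ s in (0:ℝ)..v, f (x + t • e) s) (Fi x v) 0)
    {u : Plane → ℝ} {x : Plane} (hx : x ∈ s) (hu : DifferentiableAt ℝ u x) :
    HasLineDerivAt ℝ (fun x => ∫ t in (0 : ℝ)..(u x), f x t)
      (Fi x (u x) + f x (u x) * fderiv ℝ u x e) x e := by
  have hline : Continuous fun t : ℝ => x + t • e := by fun_prop
  have hmem : ∀ᶠ t in 𝓝 (0 : ℝ), x + t • e ∈ s :=
    hline.continuousAt.eventually_mem (hs.mem_nhds (by simpa using hx))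
  have hw : HasDerivAt (fun t : ℝ => u (x + t • e)) (fderiv ℝ u x e) 0 :=
    hu.hasFDerivAt.hasLineDerivAt e
  have h1 := hasDerivAt_sub_comp (φ := fun t v => ∫ s in (0 : ℝ)..v, f (x + t • e) s)
    (p := fun t v => Fi (x + t • e) v) (w := fun t => u (x + t • e)) hw.continuousAt
    (by
      have h : ContinuousAt (fun q : Plane × ℝ => Fi q.1 q.2) (x, u x) :=
        hFi_cont.continuousAt ((hs.prod isOpen_univ).mem_nhds ⟨hx, mem_univ _⟩)
      refine ContinuousAt.comp_of_eq (g := fun q : Plane × ℝ => Fi q.1 q.2)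
        (f := fun q : ℝ × ℝ => (x + q.1 • e, q.2)) h (by fun_prop) (by simp))
    (by
      filter_upwards [hmem] with t ht v
      have h := hFi _ ht v
      have h2 : HasDerivAt (fun r : ℝ => ∫ s in (0:ℝ)..v, f (x + t • e + r • e) s)
        (Fi (x + t • e) v) (t - t) := by rwa [sub_self]
      refine (h2.comp_sub_const t t).congr_of_eventuallyEq (Eventually.of_forall fun r => ?_)
      simp only [add_assoc, ← add_smul, add_sub_cancel])
  have hfx : Continuous (f x) :=
    hf.comp_continuous (f := fun t : ℝ => (x, t)) (by fun_prop) fun t => ⟨hx, mem_univ _⟩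
  have h2 : HasDerivAt (fun v => ∫ s in (0 : ℝ)..v, f x s) (f x (u x)) (u (x + (0 : ℝ) • e)) := by
    simpa using intervalIntegral.integral_hasDerivAt_right (hfx.intervalIntegrable 0 (u x))
      (hfx.stronglyMeasurableAtFilter _ _) hfx.continuousAt
  have h3 := h1.add (h2.comp (0 : ℝ) hw)
  simp only [zero_smul, add_zero] at h3
  refine h3.congr_of_eventuallyEq (Eventually.of_forall fun t => ?_)
  simp

lemma integrableOn_sphere (z : Plane) {δ : ℝ} (hδ : 0 < δ) {g : Plane → ℝ}
    (hg : ContinuousOn g (Metric.sphere z δ)) : IntegrableOn g (Metric.sphere z δ) μH[1] := by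
  have := isFiniteMeasure_restrict_sphere z hδ
  obtain ⟨C, hC⟩ := (isCompact_sphere z δ).exists_bound_of_continuousOn hg
  refine Integrable.of_bound (hg.aestronglyMeasurable Metric.isClosed_sphere.measurableSet) C ?_
  filter_upwards [ae_restrict_mem Metric.isClosed_sphere.measurableSet] with x hx using hC x hx

/-- The Pohozaev flux through a circle of a field with prescribed divergence and zero curl. -/
lemma integral_sphere_flux_of_div_of_curl (i : Fin 2) (z : Plane) {δ : ℝ} (hδ : 0 < δ)
    {a : Fin 2 → Plane → ℝ} {h : Plane → ℝ} (ha : ∀ j, ContDiff ℝ 1 (a j))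
    (hcurl : ∀ x, ∀ j k, fderiv ℝ (a j) x (EuclideanSpace.single k 1) =
      fderiv ℝ (a k) x (EuclideanSpace.single j 1))
    (hdiv : ∀ x ∈ Metric.ball z δ,
      ∑ j, fderiv ℝ (a j) x (EuclideanSpace.single j 1) = -h x) :
    ∫ x in Metric.sphere z δ, (a i x * ∑ j, a j x * ((x j - z j) / δ) -
        1 / 2 * ((∑ j, a j x ^ 2) * ((x i - z i) / δ))) ∂μH[1] =
      -∫ x in Metric.ball z δ, a i x * h x := by
  have hc : ∀ j, Continuous (a j) := fun j => (ha j).continuous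
  have hdc : ∀ j k, Continuous fun x => fderiv ℝ (a j) x (EuclideanSpace.single k 1) :=
    fun j k => ((ha j).continuous_fderiv one_ne_zero).clm_apply continuous_const
  have hline : ∀ j k x, HasLineDerivAt ℝ (a j) (fderiv ℝ (a j) x (EuclideanSpace.single k 1)) x
      (EuclideanSpace.single k 1) := fun j k x =>
    (((ha j).differentiable one_ne_zero) x).hasFDerivAt.hasLineDerivAt _
  have hprod : ∀ j k l x, HasLineDerivAt ℝ (fun y => a j y * a l y)
      (fderiv ℝ (a j) x (EuclideanSpace.single k 1) * a l x +
        a j x * fderiv ℝ (a l) x (EuclideanSpace.single k 1)) x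
      (EuclideanSpace.single k 1) := fun j k l x => by
    have := HasDerivAt.mul (hline j k x) (hline l k x)
    simp only [zero_smul, add_zero] at this
    exact this
  have hflux : ∀ j k l, ∫ x in Metric.sphere z δ, a j x * a l x * ((x k - z k) / δ) ∂μH[1] =
      ∫ x in Metric.ball z δ, (fderiv ℝ (a j) x (EuclideanSpace.single k 1) * a l x +
        a j x * fderiv ℝ (a l) x (EuclideanSpace.single k 1)) := fun j k l =>
    integral_sphere_mul_normal_eq_integral_ball k z hδ ((hc j).mul (hc l)).continuousOn
      (((hdc j k).mul (hc l)).add ((hc j).mul (hdc l k))).continuousOn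
      fun x _ => hprod j k l x
  have hS : ∀ j k l, IntegrableOn (fun x => a j x * a l x * ((x k - z k) / δ))
      (Metric.sphere z δ) μH[1] := fun j k l => by
    have := hc j
    have := hc l
    exact integrableOn_sphere z hδ (by fun_prop)
  have hB : ∀ j k l, IntegrableOn (fun x => fderiv ℝ (a j) x (EuclideanSpace.single k 1) * a l x +
      a j x * fderiv ℝ (a l) x (EuclideanSpace.single k 1)) (Metric.ball z δ) := fun j k l =>
    ((((hdc j k).mul (hc l)).add ((hc j).mul (hdc l k))).continuousOn.integrableOn_compact
      (isCompact_closedBall z δ)).mono_set Metric.ball_subset_closedBall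
  have hS' : ∀ j, IntegrableOn (fun x => a i x * a j x * ((x j - z j) / δ) -
      1 / 2 * (a j x * a j x * ((x i - z i) / δ))) (Metric.sphere z δ) μH[1] := fun j =>
    (hS i j j).sub ((hS j i j).const_mul _)
  have hB' : ∀ j, IntegrableOn (fun x =>
      (fderiv ℝ (a i) x (EuclideanSpace.single j 1) * a j x +
        a i x * fderiv ℝ (a j) x (EuclideanSpace.single j 1)) -
      1 / 2 * (fderiv ℝ (a j) x (EuclideanSpace.single i 1) * a j x +
        a j x * fderiv ℝ (a j) x (EuclideanSpace.single i 1))) (Metric.ball z δ) := fun j =>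
    (hB i j j).sub ((hB j i j).const_mul _)
  have hL : ∫ x in Metric.sphere z δ, (a i x * ∑ j, a j x * ((x j - z j) / δ) -
        1 / 2 * ((∑ j, a j x ^ 2) * ((x i - z i) / δ))) ∂μH[1] =
      ∑ j, (∫ x in Metric.sphere z δ, a i x * a j x * ((x j - z j) / δ) ∂μH[1] -
        1 / 2 * ∫ x in Metric.sphere z δ, a j x * a j x * ((x i - z i) / δ) ∂μH[1]) := by
    simp_rw [← integral_const_mul]
    rw [Finset.sum_congr rfl fun j _ => (integral_sub (hS i j j) ((hS j i j).const_mul _)).symm,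
      ← integral_finsetSum _ fun j _ => hS' j]
    refine integral_congr_ae (Eventually.of_forall fun x => ?_)
    simp only [Fin.sum_univ_two]
    ring
  rw [hL, ← integral_neg]
  simp_rw [hflux, ← integral_const_mul]
  rw [Finset.sum_congr rfl fun j _ => (integral_sub (hB i j j) ((hB j i j).const_mul _)).symm,
    ← integral_finsetSum _ fun j _ => hB' j]
  refine setIntegral_congr_fun measurableSet_ball fun x hx => ?_
  have h1 := hdiv x hx
  simp only [Fin.sum_univ_two] at h1 ⊢
  rw [hcurl x i 0, hcurl x i 1]
  linear_combination a i x * h1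

lemma fderiv_convolution_right_apply {L : ℝ →L[ℝ] ℝ →L[ℝ] ℝ} {f g : Plane → ℝ}
    (hf : LocallyIntegrable f) (hcg : HasCompactSupport g) (hg : ContDiff ℝ 1 g) (x e : Plane) :
    fderiv ℝ (f ⋆[L, volume] g) x e = (f ⋆[L, volume] fun y => fderiv ℝ g y e) x := by
  rw [(hcg.hasFDerivAt_convolution_right L hf hg x).fderiv]
  exact convolution_precompR_apply L hf (hcg.fderiv ℝ) (hg.continuous_fderiv one_ne_zero) x e

lemma fderiv_convolution_left_apply {ρ P : Plane → ℝ} (hcρ : HasCompactSupport ρ)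
    (hρ : ContDiff ℝ 1 ρ) (hP : LocallyIntegrable P) (x e : Plane) :
    fderiv ℝ (ρ ⋆[ContinuousLinearMap.lsmul ℝ ℝ, volume] P) x e =
      ∫ y, P y * fderiv ℝ ρ (x - y) e := by
  rw [← convolution_flip, fderiv_convolution_right_apply hP hcρ hρ, convolution_def]
  refine integral_congr_ae (Eventually.of_forall fun y => ?_)
  simp [mul_comm]

lemma contDiff_mul_of_tsupport_subset {n : WithTop ℕ∞} {χ h : Plane → ℝ} {s : Set Plane}
    (hs : IsOpen s) (hχ : ContDiff ℝ n χ) (hχs : tsupport χ ⊆ s) (hh : ContDiffOn ℝ n h s) :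
    ContDiff ℝ n fun x => χ x * h x := by
  refine contDiff_iff_contDiffAt.2 fun x => ?_
  by_cases hx : x ∈ s
  · exact hχ.contDiffAt.mul (hh.contDiffAt (hs.mem_nhds hx))
  · refine contDiffAt_const (c := (0 : ℝ)) |>.congr_of_eventuallyEq ?_
    filter_upwards [notMem_tsupport_iff_eventuallyEq.1 (mt (@hχs x) hx)] with y hy
    rw [hy]
    simp

lemma gradient_apply (u : Plane → ℝ) (x : Plane) (j : Fin 2) :
    gradient u x j = fderiv ℝ u x (EuclideanSpace.single j 1) := by
  have h := InnerProductSpace.toDual_symm_apply (𝕜 := ℝ) (x := EuclideanSpace.single j (1 : ℝ))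
    (y := fderiv ℝ u x)
  rw [EuclideanSpace.inner_single_right] at h
  simpa [gradient] using h

lemma abs_normed_convolution_le (φ : ContDiffBump (0 : Plane)) {g : Plane → ℝ}
    (hg : Continuous g) {C : ℝ} (hC : ∀ x, ‖g x‖ ≤ C) (x : Plane) :
    ‖(φ.normed volume ⋆[ContinuousLinearMap.lsmul ℝ ℝ, volume] g) x‖ ≤ 3 * C := by
  have h := φ.dist_normed_convolution_le (μ := volume) (x₀ := x) (ε := 2 * C)
    hg.aestronglyMeasurable fun y _ => by
      rw [dist_eq_norm]
      linarith [norm_sub_le (g y) (g x), hC x, hC y]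
  rw [dist_eq_norm] at h
  have h2 := norm_add_le ((φ.normed volume ⋆[ContinuousLinearMap.lsmul ℝ ℝ, volume] g) x - g x)
    (g x)
  rw [sub_add_cancel] at h2
  linarith [hC x]

lemma fderiv_fderiv_apply_comm {W : Plane → ℝ} (hW : ContDiff ℝ 2 W) (x v w : Plane) :
    fderiv ℝ (fun y => fderiv ℝ W y v) x w = fderiv ℝ (fun y => fderiv ℝ W y w) x v := by
  have hd : DifferentiableAt ℝ (fderiv ℝ W) x :=
    ((hW.fderiv_right (m := 1) (by norm_num)).differentiable one_ne_zero) x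
  have happ : ∀ v w, fderiv ℝ (fun y => fderiv ℝ W y v) x w = fderiv ℝ (fderiv ℝ W) x w v := by
    intro v w
    rw [fderiv_clm_apply hd (differentiableAt_const v)]
    simp
  rw [happ, happ]
  exact (hW.contDiffAt.isSymmSndFDerivAt (by simp)) w v

/-- Mollifying a weak solution of `−Δu = h` gives a classical solution with mollified right-hand
side. -/
lemma sum_fderiv_convolution_eq_neg_convolution {s : Set Plane} (hs : IsOpen s) {u h : Plane → ℝ}
    (hweak : ∀ φ : Plane → ℝ, ContDiff ℝ (⊤ : ℕ∞) φ → HasCompactSupport φ → tsupport φ ⊆ s →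
      ∫ x in s, ⟪gradient u x, gradient φ x⟫ = ∫ x in s, h x * φ x)
    {U H : Plane → ℝ} (hU : ContDiff ℝ 1 U) (hUc : HasCompactSupport U) {V : Set Plane}
    (hV : IsOpen V) (hVs : V ⊆ s) (hUu : EqOn U u V) (hHh : EqOn H h V)
    (φ : ContDiffBump (0 : Plane)) {x : Plane} (hx : Metric.closedBall x φ.rOut ⊆ V) :
    ∑ j, fderiv ℝ (φ.normed volume ⋆[ContinuousLinearMap.lsmul ℝ ℝ, volume]
        fun y => fderiv ℝ U y (EuclideanSpace.single j 1)) x (EuclideanSpace.single j 1) =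
      -(φ.normed volume ⋆[ContinuousLinearMap.lsmul ℝ ℝ, volume] H) x := by
  set ρ := φ.normed volume with hρdef
  have hρ : ContDiff ℝ (⊤ : ℕ∞) ρ := φ.contDiff_normed
  have hρc : HasCompactSupport ρ := φ.hasCompactSupport_normed
  have hPc : ∀ j, Continuous fun y => fderiv ℝ U y (EuclideanSpace.single j (1 : ℝ)) :=
    fun j => (hU.continuous_fderiv one_ne_zero).clm_apply continuous_const
  set ψ : Plane → ℝ := fun y => ρ (x - y) with hψ
  have hψs : ContDiff ℝ (⊤ : ℕ∞) ψ := hρ.comp (contDiff_const.sub contDiff_id)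
  have hψt : tsupport ψ ⊆ Metric.closedBall x φ.rOut := by
    refine closure_minimal (fun y hy => ?_) Metric.isClosed_closedBall
    have h1 : x - y ∈ Function.support ρ := hy
    rw [hρdef, φ.support_normed_eq, mem_ball_zero_iff, ← dist_eq_norm, dist_comm] at h1
    exact h1.le
  have hψc : HasCompactSupport ψ :=
    HasCompactSupport.of_support_subset_isCompact (isCompact_closedBall x φ.rOut)
      ((subset_tsupport ψ).trans hψt)
  have hψV : tsupport ψ ⊆ V := hψt.trans hx
  have hψd : ∀ y e, fderiv ℝ ψ y e = -fderiv ℝ ρ (x - y) e := fun y e => by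
    have h1 : HasFDerivAt ρ (fderiv ℝ ρ (x - y)) (x - y) :=
      (hρ.differentiable (by simp) _).hasFDerivAt
    have h2 := h1.comp y ((hasFDerivAt_id y).const_sub x)
    have h3 : fderiv ℝ ψ y = _ := h2.fderiv
    rw [h3]
    simp
  have hw := hweak ψ hψs hψc (hψV.trans hVs)
  have hright : ∫ y in s, h y * ψ y =
      (ρ ⋆[ContinuousLinearMap.lsmul ℝ ℝ, volume] H) x := by
    rw [convolution_eq_swap, ← integral_indicator hs.measurableSet]
    refine integral_congr_ae (Eventually.of_forall fun y => ?_)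
    by_cases hy : y ∈ V
    · simp [indicator_of_mem (hVs hy), hHh hy, hψ, mul_comm]
    · have h0 : ψ y = 0 := image_eq_zero_of_notMem_tsupport (mt (@hψV y) hy)
      have h0' : ρ (x - y) = 0 := h0
      simp only [h0', map_zero, zero_apply]
      exact indicator_apply_eq_zero.2 fun _ => by rw [h0, mul_zero]
  have hleft : ∫ y in s, ⟪gradient u y, gradient ψ y⟫ =
      ∫ y, ∑ j, -(fderiv ℝ U y (EuclideanSpace.single j 1) *
        fderiv ℝ ρ (x - y) (EuclideanSpace.single j 1)) := by
    rw [← integral_indicator hs.measurableSet]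
    refine integral_congr_ae (Eventually.of_forall fun y => ?_)
    by_cases hy : y ∈ V
    · have hUe : fderiv ℝ U y = fderiv ℝ u y :=
        (hUu.eventuallyEq_of_mem (hV.mem_nhds hy)).fderiv_eq
      simp only [indicator_of_mem (hVs hy), PiLp.inner_apply, gradient_apply, hψd, hUe]
      simp [mul_comm]
    · have h0 : fderiv ℝ ψ y = 0 := by
        have : y ∉ tsupport ψ := mt (@hψV y) hy
        exact image_eq_zero_of_notMem_tsupport
          (mt (fun h' => tsupport_fderiv_subset ℝ h') this)
      have h1 : ∀ e, fderiv ℝ ρ (x - y) e = 0 := fun e => by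
        have := hψd y e
        rw [h0] at this
        simpa using this.symm
      have h2 : gradient ψ y = 0 := by simp [gradient, h0]
      simp only [h1, mul_zero, neg_zero, Finset.sum_const_zero]
      exact indicator_apply_eq_zero.2 fun _ => by rw [h2, inner_zero_right]
  rw [hleft, hright, integral_finsetSum] at hw
  · rw [← hw, ← Finset.sum_neg_distrib]
    refine Finset.sum_congr rfl fun j _ => ?_
    rw [fderiv_convolution_left_apply hρc (hρ.of_le (by exact_mod_cast le_top))
      (hPc j).locallyIntegrable, integral_neg, neg_neg]
  · intro j _
    have hρd : Continuous fun y => fderiv ℝ ρ (x - y) (EuclideanSpace.single j (1 : ℝ)) :=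
      ((hρ.continuous_fderiv (by simp)).comp (continuous_const.sub continuous_id)).clm_apply
        continuous_const
    refine (((hPc j).mul hρd).integrable_of_hasCompactSupport ?_).neg
    exact (hUc.fderiv_apply ℝ _).mul_right

/-- The Pohozaev identity for a `C¹` weak solution of `−Δu = h`, with `h` continuous. -/
lemma integral_sphere_flux_of_weak_solution {s : Set Plane} (hs : IsOpen s) {u h : Plane → ℝ}
    (hu : ContDiffOn ℝ 1 u s) (hh : ContinuousOn h s)
    (hweak : ∀ φ : Plane → ℝ, ContDiff ℝ (⊤ : ℕ∞) φ → HasCompactSupport φ → tsupport φ ⊆ s →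
      ∫ x in s, ⟪gradient u x, gradient φ x⟫ = ∫ x in s, h x * φ x)
    (i : Fin 2) (z : Plane) {δ : ℝ} (hδ : 0 < δ) (hball : Metric.closedBall z δ ⊆ s) :
    ∫ x in Metric.sphere z δ, (gradient u x i * ∑ j, gradient u x j * ((x j - z j) / δ) -
        1 / 2 * ((∑ j, gradient u x j ^ 2) * ((x i - z i) / δ))) ∂μH[1] =
      -∫ x in Metric.ball z δ, gradient u x i * h x := by
  obtain ⟨η, hη, hηs⟩ := (isCompact_closedBall z δ).exists_cthickening_subset_open hs hball
  rw [cthickening_closedBall hη.le hδ.le, add_comm] at hηs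
  let χ : ContDiffBump z := ⟨δ + η / 2, δ + η, by positivity, by linarith⟩
  have hχs : tsupport χ ⊆ s := by rw [χ.tsupport_eq]; exact hηs
  set V := Metric.ball z (δ + η / 2) with hVdef
  have hVs : V ⊆ s :=
    (Metric.ball_subset_closedBall.trans (Metric.closedBall_subset_closedBall (by linarith))).trans
      hηs
  have hχV : ∀ x ∈ V, χ x = 1 := fun x hx =>
    χ.one_of_mem_closedBall (Metric.ball_subset_closedBall hx)
  have hδV : Metric.closedBall z δ ⊆ V := Metric.closedBall_subset_ball (by linarith)
  set U : Plane → ℝ := fun x => χ x * u x with hUdef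
  set H : Plane → ℝ := fun x => χ x * h x with hHdef
  have hU : ContDiff ℝ 1 U := contDiff_mul_of_tsupport_subset hs χ.contDiff hχs hu
  have hH : Continuous H :=
    (contDiff_mul_of_tsupport_subset (n := 0) hs χ.contDiff hχs (contDiffOn_zero.2 hh)).continuous
  have hUc : HasCompactSupport U := χ.hasCompactSupport.mul_right
  have hHc : HasCompactSupport H := χ.hasCompactSupport.mul_right
  have hUu : EqOn U u V := fun x hx => by simp [hUdef, hχV x hx]
  have hHh : EqOn H h V := fun x hx => by simp [hHdef, hχV x hx]
  set P : Fin 2 → Plane → ℝ := fun j x => fderiv ℝ U x (EuclideanSpace.single j 1) with hPdef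
  have hP : ∀ j, Continuous (P j) :=
    fun j => (hU.continuous_fderiv one_ne_zero).clm_apply continuous_const
  have hPc : ∀ j, HasCompactSupport (P j) := fun j => hUc.fderiv_apply ℝ _
  have hPu : ∀ j, ∀ x ∈ V, P j x = gradient u x j := fun j x hx => by
    rw [gradient_apply, hPdef]
    have : fderiv ℝ U x = fderiv ℝ u x :=
      (hUu.eventuallyEq_of_mem (Metric.isOpen_ball.mem_nhds hx)).fderiv_eq
    simp only [this]
  let φ : ℕ → ContDiffBump (0 : Plane) := fun n =>
    ⟨η / 8 / (n + 1), η / 4 / (n + 1), by positivity, by gcongr; linarith⟩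
  have hφle : ∀ n, (φ n).rOut ≤ η / 4 := fun n =>
    div_le_self (by positivity) (by linarith [n.cast_nonneg (α := ℝ)])
  have hφ : Tendsto (fun n => (φ n).rOut) atTop (𝓝 0) := by
    have := (tendsto_one_div_add_atTop_nhds_zero_nat (𝕜 := ℝ)).const_mul (η / 4)
    simpa only [mul_one_div, mul_zero] using this
  let M : ℕ → (Plane → ℝ) → Plane → ℝ := fun n g =>
    (φ n).normed volume ⋆[ContinuousLinearMap.lsmul ℝ ℝ, volume] g
  have hMs : ∀ n g, Continuous g → ContDiff ℝ (⊤ : ℕ∞) (M n g) := fun n g hg =>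
    (φ n).hasCompactSupport_normed.contDiff_convolution_left _ (φ n).contDiff_normed
      hg.locallyIntegrable
  have hMlim : ∀ g, Continuous g → ∀ x, Tendsto (fun n => M n g x) atTop (𝓝 (g x)) :=
    fun g hg x => ContDiffBump.convolution_tendsto_right_of_continuous hφ hg x
  have hMbdd : ∀ g, Continuous g → HasCompactSupport g → ∃ C, ∀ n x, |M n g x| ≤ C := by
    intro g hg hgc
    obtain ⟨C, hC⟩ := hgc.exists_bound_of_continuous hg
    exact ⟨3 * C, fun n x => abs_normed_convolution_le (φ n) hg hC x⟩
  have hMP : ∀ n j, M n (P j) = fun x => fderiv ℝ (M n U) x (EuclideanSpace.single j 1) :=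
    fun n j => funext fun x => (fderiv_convolution_right_apply
      (φ n).continuous_normed.locallyIntegrable hUc hU x _).symm
  have hid : ∀ n, ∫ x in Metric.sphere z δ,
      (M n (P i) x * ∑ j, M n (P j) x * ((x j - z j) / δ) -
        1 / 2 * ((∑ j, M n (P j) x ^ 2) * ((x i - z i) / δ))) ∂μH[1] =
      -∫ x in Metric.ball z δ, M n (P i) x * M n H x := by
    intro n
    refine integral_sphere_flux_of_div_of_curl i z hδ (a := fun j => M n (P j))
      (fun j => (hMs n _ (hP j)).of_le (by exact_mod_cast le_top)) (fun x j k => ?_) fun x hx => ?_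
    · simp only [hMP]
      exact fderiv_fderiv_apply_comm (contDiff_infty.1 (hMs n U hU.continuous) 2) _ _ _
    · refine sum_fderiv_convolution_eq_neg_convolution hs hweak hU hUc Metric.isOpen_ball hVs hUu
        hHh (φ n) (Metric.closedBall_subset_ball' ?_)
      linarith [hφle n, Metric.mem_ball.1 hx]
  choose C hC using fun j => hMbdd (P j) (hP j) (hPc j)
  obtain ⟨D, hD⟩ := hMbdd H hH hHc
  have hC0 : ∀ j, 0 ≤ C j := fun j => (abs_nonneg _).trans (hC j 0 0)
  have hMc : ∀ n j, Continuous (M n (P j)) := fun n j => (hMs n _ (hP j)).continuous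
  have hMHc : ∀ n, Continuous (M n H) := fun n => (hMs n _ hH).continuous
  have := isFiniteMeasure_restrict_sphere z hδ
  have hlimS := tendsto_integral_of_dominated_convergence
    (μ := (μH[1] : Measure Plane).restrict (Metric.sphere z δ))
    (F := fun n x => M n (P i) x * ∑ j, M n (P j) x * ((x j - z j) / δ) -
        1 / 2 * ((∑ j, M n (P j) x ^ 2) * ((x i - z i) / δ)))
    (f := fun x => P i x * ∑ j, P j x * ((x j - z j) / δ) -
        1 / 2 * ((∑ j, P j x ^ 2) * ((x i - z i) / δ)))
    (fun _ => C i * ∑ j, C j + 1 / 2 * ∑ j, C j ^ 2)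
    (fun n => by
      have := hMc n
      exact (by fun_prop : Continuous _).aestronglyMeasurable)
    (integrable_const _)
    (fun n => by
      filter_upwards [ae_restrict_mem Metric.isClosed_sphere.measurableSet] with x hx
      have hν : ∀ j, |(x j - z j) / δ| ≤ 1 := fun j => by
        rw [abs_div, abs_of_pos hδ, div_le_one hδ]
        have := PiLp.norm_apply_le (x - z) j
        rwa [mem_sphere_iff_norm.1 hx, Real.norm_eq_abs, PiLp.sub_apply] at this
      rw [Real.norm_eq_abs]
      refine (abs_sub _ _).trans (add_le_add ?_ ?_)
      · rw [abs_mul]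
        refine mul_le_mul (hC i n x) ((Finset.abs_sum_le_sum_abs _ _).trans
          (Finset.sum_le_sum fun j _ => ?_)) (abs_nonneg _) (hC0 i)
        rw [abs_mul]
        exact (mul_le_mul (hC j n x) (hν j) (abs_nonneg _) (hC0 j)).trans_eq (mul_one _)
      · rw [abs_mul, abs_of_pos (by norm_num : (0 : ℝ) < 1 / 2), abs_mul]
        refine mul_le_mul_of_nonneg_left ?_ (by norm_num)
        refine (mul_le_of_le_one_right (abs_nonneg _) (hν i)).trans
          ((Finset.abs_sum_le_sum_abs _ _).trans (Finset.sum_le_sum fun j _ => ?_))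
        rw [abs_pow]
        exact pow_le_pow_left₀ (abs_nonneg _) (hC j n x) 2)
    (Eventually.of_forall fun x =>
      ((hMlim _ (hP i) x).mul (tendsto_finsetSum _ fun j _ =>
        (hMlim _ (hP j) x).mul_const _)).sub
      (((tendsto_finsetSum _ fun j _ => (hMlim _ (hP j) x).pow 2).mul_const _).const_mul _))
  have hlimB := tendsto_integral_of_dominated_convergence
    (μ := volume.restrict (Metric.ball z δ))
    (F := fun n x => M n (P i) x * M n H x) (f := fun x => P i x * H x)
    (fun _ => C i * D)
    (fun n => ((hMc n i).mul (hMHc n)).aestronglyMeasurable)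
    (integrableOn_const measure_ball_lt_top.ne)
    (fun n => Eventually.of_forall fun x => by
      rw [norm_mul]
      exact mul_le_mul (hC i n x) (hD n x) (norm_nonneg _) (hC0 i))
    (Eventually.of_forall fun x => (hMlim _ (hP i) x).mul (hMlim _ hH x))
  simp only [hid] at hlimS
  have hkey := tendsto_nhds_unique hlimS hlimB.neg
  have hS : ∫ x in Metric.sphere z δ, (gradient u x i * ∑ j, gradient u x j * ((x j - z j) / δ) -
        1 / 2 * ((∑ j, gradient u x j ^ 2) * ((x i - z i) / δ))) ∂μH[1] =
      ∫ x in Metric.sphere z δ, (P i x * ∑ j, P j x * ((x j - z j) / δ) -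
        1 / 2 * ((∑ j, P j x ^ 2) * ((x i - z i) / δ))) ∂μH[1] :=
    setIntegral_congr_fun Metric.isClosed_sphere.measurableSet fun x hx => by
      simp only [hPu _ x (hδV (Metric.sphere_subset_closedBall hx))]
  have hB : ∫ x in Metric.ball z δ, gradient u x i * h x =
      ∫ x in Metric.ball z δ, P i x * H x :=
    setIntegral_congr_fun measurableSet_ball fun x hx => by
      have hxV := hδV (Metric.ball_subset_closedBall hx)
      simp only [hPu _ x hxV, hHh hxV]
  rw [hS, hB, hkey]

end Auxiliary

/-- **Local Pohozaev identity** (Lemma C.1). If `u` is a finite-energy `C¹` weak solution of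
`−Δu = f(x,u)` on the half plane, `F(x,v) = ∫₀ᵛ f(x,t) dt`, and `Fi` is the (continuous)
partial derivative `∂F/∂xᵢ`, then for every closed ball `B̄_δ(z)` inside the half plane,
`∫_{∂B_δ(z)} ∂ᵢu ∂_ν u − ½ ∫_{∂B_δ(z)} |∇u|² νᵢ + ∫_{∂B_δ(z)} F(x,u) νᵢ
  = ∫_{B_δ(z)} (∂F/∂xᵢ)(x, u(x))`. -/
theorem local_pohozaev_identity (f : Plane → ℝ → ℝ)
    (hf_cont : ContinuousOn (fun q : Plane × ℝ => f q.1 q.2) (halfPlane ×ˢ Set.univ))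
    (hf_mono : ∀ x ∈ halfPlane, Monotone (f x))
    (u : Plane → ℝ)
    (hu : ContDiffOn ℝ 1 u halfPlane)
    (hint : IntegrableOn (fun x => (u x) ^ 2 + ‖gradient u x‖ ^ 2) halfPlane)
    (hweak : ∀ φ : Plane → ℝ, ContDiff ℝ (⊤ : ℕ∞) φ → HasCompactSupport φ →
      tsupport φ ⊆ halfPlane →
      ∫ x in halfPlane, ⟪gradient u x, gradient φ x⟫
        = ∫ x in halfPlane, f x (u x) * φ x)
    (i : Fin 2) (Fi : Plane → ℝ → ℝ)
    (hFi_cont : ContinuousOn (fun q : Plane × ℝ => Fi q.1 q.2) (halfPlane ×ˢ Set.univ))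
    (hFi : ∀ x ∈ halfPlane, ∀ v : ℝ,
      HasDerivAt
        (fun t : ℝ => ∫ s in (0:ℝ)..v, f (x + t • EuclideanSpace.single i 1) s)
        (Fi x v) 0)
    (z : Plane) (δ : ℝ) (hδ : 0 < δ) (hball : Metric.closedBall z δ ⊆ halfPlane) :
    (∫ x in Metric.sphere z δ,
        (gradient u x i) * (⟪gradient u x, x - z⟫ / δ) ∂μH[1])
      - (1 / 2) * (∫ x in Metric.sphere z δ, ‖gradient u x‖ ^ 2 * ((x i - z i) / δ) ∂μH[1])
      + (∫ x in Metric.sphere z δ, (∫ s in (0:ℝ)..(u x), f x s) * ((x i - z i) / δ) ∂μH[1])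
    = ∫ x in Metric.ball z δ, Fi x (u x) := by
  have hgrad : ∀ j, ContinuousOn (fun x => gradient u x j) halfPlane := fun j => by
    simp only [gradient_apply]
    exact (hu.continuousOn_fderiv_of_isOpen isOpen_halfPlane le_rfl).clm_apply continuousOn_const
  have hfu : ContinuousOn (fun x => f x (u x)) halfPlane :=
    hf_cont.comp (continuousOn_id.prodMk hu.continuousOn) fun x hx => ⟨hx, Set.mem_univ _⟩
  have hFiu : ContinuousOn (fun x => Fi x (u x)) halfPlane :=
    hFi_cont.comp (continuousOn_id.prodMk hu.continuousOn) fun x hx => ⟨hx, Set.mem_univ _⟩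
  have hsphere : Metric.sphere z δ ⊆ halfPlane := Metric.sphere_subset_closedBall.trans hball
  have hdiff : ∀ x ∈ halfPlane, DifferentiableAt ℝ u x := fun x hx =>
    (hu.contDiffAt (isOpen_halfPlane.mem_nhds hx)).differentiableAt one_ne_zero
  have hflux := integral_sphere_flux_of_weak_solution isOpen_halfPlane hu hfu hweak i z hδ hball
  have hF := integral_sphere_mul_normal_eq_integral_ball i z hδ
    (G := fun x => ∫ s in (0:ℝ)..(u x), f x s)
    (g := fun x => Fi x (u x) + f x (u x) * gradient u x i)
    ((continuousOn_primitive_comp hf_cont hu.continuousOn).mono hball)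
    ((hFiu.add (hfu.mul (hgrad i))).mono hball) fun x hx => by
      have hx' := hball (Metric.ball_subset_closedBall hx)
      rw [gradient_apply]
      exact hasLineDerivAt_primitive_comp isOpen_halfPlane hf_cont hFi_cont hFi hx' (hdiff x hx')
  have hball_int : ∀ {g : Plane → ℝ}, ContinuousOn g halfPlane →
      IntegrableOn g (Metric.ball z δ) := fun hg =>
    ((hg.mono hball).integrableOn_compact (isCompact_closedBall z δ)).mono_set
      Metric.ball_subset_closedBall
  have hinner : ∀ x, ⟪gradient u x, x - z⟫ / δ = ∑ j, gradient u x j * ((x j - z j) / δ) := by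
    intro x
    rw [PiLp.inner_apply, Finset.sum_div]
    refine Finset.sum_congr rfl fun j _ => ?_
    simp
    ring
  have hfu_grad : IntegrableOn (fun x => f x (u x) * gradient u x i) (Metric.ball z δ) :=
    hball_int (hfu.mul (hgrad i))
  rw [hF, integral_add (hball_int hFiu) hfu_grad]
  simp_rw [hinner, EuclideanSpace.real_norm_sq_eq]
  rw [← integral_const_mul, ← integral_sub, hflux]
  · simp_rw [mul_comm (f _ _)]
    ring
  · have := fun j => (hgrad j).mono hsphere
    exact integrableOn_sphere z hδ (by fun_prop)
  · have := fun j => (hgrad j).mono hsphere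
    exact (integrableOn_sphere z hδ (by fun_prop)).const_mul _
end
end

section
/- (Far-field expansion with symmetric-difference error.) For all constants δ₀, κ₁, κ₀, R > 0 with κ₁ ≤ κ₀ there exist C > 0 and ε₀ > 0 with the following property, where L := 2(R + √(κ₀/(π δ₀)) + 1). Let ε ∈ (0, ε₀], z = (z₁, 0) with δ₀ ≤ z₁ ≤ 1/δ₀, and let A ⊆ B_{Rε}(z) be a measurable set with κ := ε^{−2} ∫_A x₁ dx ∈ [κ₁, κ₀]; set s₀ := ε √(κ/(π z₁)), let e be the Lebesgue measure of the symmetric difference A Δ B_{s₀}(z), and define ψ₁(x) := (z₁²/(2π ε²)) ∫_A ln(|x − x̄'|/|x − x'|) dx' for x ∈ Π. Then for every x ∈ Π with |x − z| ≥ L ε: |ψ₁(x) − (κ z₁/(2π)) ln(|x − z̄|/|x − z|)| ≤ C e/(ε |x − z|), and |∇ψ₁(x) + (κ z₁/(2π))[(x − z)/|x − z|² − (x − z̄)/|x − z̄|²]| ≤ C e/(ε |x − z|²). -/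
open MeasureTheory Real Filter
open scoped RealInnerProductSpace

noncomputable section

theorem setIntegral_ball_eq_of_circleAverage {g : ℂ → ℝ} {c : ℂ} {r m : ℝ} (hr : 0 ≤ r)
    (hg : ContinuousOn g (Metric.closedBall c r))
    (h : ∀ t ∈ Set.Ioo 0 r, circleAverage g c t = m) :
    ∫ w in Metric.ball c r, g w = π * r ^ 2 * m := by
  have hpolar (p : ℝ × ℝ) : c + Complex.polarCoord.symm p = circleMap c p.1 p.2 := by
    simp [Complex.polarCoord_symm_apply, circleMap, Complex.exp_mul_I]
  have hinner (t : ℝ) (ht : t ∈ Set.Ioo 0 r) :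
      ∫ θ in Set.Ioo (-π) π, t * g (circleMap c t θ) = t * (2 * π * m) := by
    rw [integral_const_mul, ← integral_Ioc_eq_integral_Ioo,
      ← intervalIntegral.integral_of_le (by linarith [pi_pos])]
    have hper : Function.Periodic (fun θ => g (circleMap c t θ)) (2 * π) := fun θ => by
      simp [periodic_circleMap c t θ]
    have hshift := hper.intervalIntegral_add_eq (-π) 0
    rw [show -π + 2 * π = π by ring, zero_add] at hshift
    rw [hshift, ← h t ht, circleAverage, smul_eq_mul]
    field_simp
  have hcont : ContinuousOn (fun p : ℝ × ℝ => p.1 * g (circleMap c p.1 p.2))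
      (Set.Icc 0 r ×ˢ Set.Icc (-π) π) := by
    refine continuousOn_fst.mul (hg.comp (by simp only [circleMap]; fun_prop) ?_)
    rintro ⟨t, θ⟩ ⟨⟨ht0, ht⟩, -⟩
    exact circleMap_mem_closedBall c ht0 θ |> Metric.closedBall_subset_closedBall ht
  have hint : IntegrableOn (fun p : ℝ × ℝ => p.1 * g (circleMap c p.1 p.2))
      (Set.Ioo 0 r ×ˢ Set.Ioo (-π) π) :=
    (hcont.integrableOn_compact (isCompact_Icc.prod isCompact_Icc)).mono_set
      (Set.prod_mono Set.Ioo_subset_Icc_self Set.Ioo_subset_Icc_self)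
  calc ∫ w in Metric.ball c r, g w
      = ∫ w, (Metric.ball c r).indicator g (c + w) := by
        rw [integral_add_left_eq_self, integral_indicator Metric.isOpen_ball.measurableSet]
    _ = ∫ p in polarCoord.target, p.1 • (Metric.ball c r).indicator g (circleMap c p.1 p.2) := by
        rw [← Complex.integral_comp_polarCoord_symm]
        simp only [hpolar]
    _ = ∫ p in Set.Ioo 0 r ×ˢ Set.Ioo (-π) π,
          p.1 • (Metric.ball c r).indicator g (circleMap c p.1 p.2) := by
        refine setIntegral_eq_of_subset_of_forall_sdiff_eq_zero
          polarCoord.open_target.measurableSet ?_ ?_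
        · exact Set.prod_mono Set.Ioo_subset_Ioi_self subset_rfl
        · rintro ⟨t, θ⟩ ⟨⟨ht, hθ⟩, hn⟩
          have hrt : r ≤ t := by
            by_contra! hlt
            exact hn ⟨⟨ht, hlt⟩, hθ⟩
          have ht0 : 0 < t := ht
          rw [Set.indicator_of_notMem, smul_zero]
          simp [circleMap, abs_of_pos ht0, hrt]
    _ = ∫ p in Set.Ioo 0 r ×ˢ Set.Ioo (-π) π, p.1 * g (circleMap c p.1 p.2) := by
        refine setIntegral_congr_fun (measurableSet_Ioo.prod measurableSet_Ioo) ?_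
        rintro ⟨t, θ⟩ ⟨⟨ht, htr⟩, -⟩
        have ht0 : 0 < t := ht
        have hmem : circleMap c t θ ∈ Metric.ball c r := by
          simpa [circleMap, abs_of_pos ht0] using htr
        simp [hmem]
    _ = ∫ t in Set.Ioo 0 r, ∫ θ in Set.Ioo (-π) π, t * g (circleMap c t θ) := by
        rw [Measure.volume_eq_prod] at hint ⊢
        exact setIntegral_prod _ hint
    _ = ∫ t in Set.Ioo 0 r, t * (2 * π * m) := setIntegral_congr_fun measurableSet_Ioo hinner
    _ = π * r ^ 2 * m := by
        rw [← integral_Ioc_eq_integral_Ioo, ← intervalIntegral.integral_of_le hr,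
          intervalIntegral.integral_mul_const, integral_id]
        ring

theorem setIntegral_ball_log_norm_sub_complex {c a : ℂ} {r : ℝ} (hr : 0 ≤ r) (ha : r < ‖a - c‖) :
    ∫ w in Metric.ball c r, Real.log ‖w - a‖ = π * r ^ 2 * Real.log ‖a - c‖ := by
  have hne (w : ℂ) (hw : w ∈ Metric.closedBall c r) : w - a ≠ 0 := by
    rw [sub_ne_zero]
    rintro rfl
    rw [mem_closedBall_iff_norm] at hw
    linarith
  refine setIntegral_ball_eq_of_circleAverage hr
    (ContinuousOn.log (by fun_prop) fun w hw => norm_ne_zero_iff.2 (hne w hw)) fun t ht => ?_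
  rw [InnerProductSpace.HarmonicOnNhd.circleAverage_eq, norm_sub_rev]
  intro w hw
  refine AnalyticAt.harmonicAt_log_norm (by fun_prop) (hne w ?_)
  rw [abs_of_pos ht.1] at hw
  exact Metric.closedBall_subset_closedBall ht.2.le hw

theorem setIntegral_ball_log_norm_sub {z y : Plane} {r : ℝ} (hr : 0 ≤ r) (hy : r < ‖y - z‖) :
    ∫ w in Metric.ball z r, Real.log ‖y - w‖ = π * r ^ 2 * Real.log ‖y - z‖ := by
  let Φ : ℂ ≃ₗᵢ[ℝ] Plane := Complex.orthonormalBasisOneI.repr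
  have hΦ : MeasurePreserving Φ := Φ.measurePreserving
  have hball : Φ ⁻¹' Metric.ball z r = Metric.ball (Φ.symm z) r := Φ.preimage_ball z r
  have hnorm (u v : Plane) : ‖Φ.symm u - Φ.symm v‖ = ‖u - v‖ := by
    rw [← map_sub, LinearIsometryEquiv.norm_map]
  rw [← hΦ.setIntegral_preimage_emb Φ.toHomeomorph.measurableEmbedding, hball, ← hnorm,
    ← setIntegral_ball_log_norm_sub_complex hr (by rwa [hnorm])]
  refine integral_congr_ae (.of_forall fun w => ?_)
  simp only
  rw [norm_sub_rev, ← LinearIsometryEquiv.norm_map Φ (w - Φ.symm y)]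
  simp

theorem volume_real_ball_plane (z : Plane) {r : ℝ} (hr : 0 ≤ r) :
    volume.real (Metric.ball z r) = π * r ^ 2 := by
  rw [Measure.real, EuclideanSpace.volume_ball_fin_two]
  simp [hr, pi_pos.le, mul_comm]

theorem norm_setIntegral_sub_setIntegral_le {α E : Type*} [MeasurableSpace α] {μ : Measure α}
    [NormedAddCommGroup E] [NormedSpace ℝ E] {f : α → E} {s t : Set α} {M : ℝ}
    (hs : MeasurableSet s) (ht : MeasurableSet t) (hμs : μ s ≠ ⊤) (hμt : μ t ≠ ⊤)
    (hfs : IntegrableOn f s μ) (hft : IntegrableOn f t μ) (hM : ∀ x ∈ s ∪ t, ‖f x‖ ≤ M) :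
    ‖∫ x in s, f x ∂μ - ∫ x in t, f x ∂μ‖ ≤ M * μ.real (symmDiff s t) := by
  have h₁ : μ (s \ t) < ⊤ := (measure_mono Set.sdiff_subset).trans_lt hμs.lt_top
  have h₂ : μ (t \ s) < ⊤ := (measure_mono Set.sdiff_subset).trans_lt hμt.lt_top
  have hvol : μ.real (symmDiff s t) = μ.real (s \ t) + μ.real (t \ s) :=
    measureReal_union (disjoint_sdiff_sdiff) (ht.diff hs) h₁.ne h₂.ne
  rw [← integral_inter_add_sdiff ht hfs, ← integral_inter_add_sdiff hs hft, Set.inter_comm t s,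
    add_sub_add_left_eq_sub, hvol, mul_add]
  exact (norm_sub_le _ _).trans (add_le_add
    (norm_setIntegral_le_of_norm_le_const h₁ fun x hx => hM x (.inl hx.1))
    (norm_setIntegral_le_of_norm_le_const h₂ fun x hx => hM x (.inr hx.1)))

theorem abs_log_sub_log_le {a b m : ℝ} (hm : 0 < m) (ha : m ≤ a) (hb : m ≤ b) :
    |Real.log a - Real.log b| ≤ |a - b| / m := by
  have key {a b : ℝ} (ha : m ≤ a) (hb : m ≤ b) : Real.log a - Real.log b ≤ |a - b| / m := by
    have hb0 : 0 < b := hm.trans_le hb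
    have ha0 : 0 < a := hm.trans_le ha
    rw [← Real.log_div ha0.ne' hb0.ne']
    calc Real.log (a / b) ≤ a / b - 1 := Real.log_le_sub_one_of_pos (div_pos ha0 hb0)
      _ = (a - b) / b := by field_simp
      _ ≤ |a - b| / b := by gcongr; exact le_abs_self _
      _ ≤ |a - b| / m := by gcongr
  refine abs_sub_le_iff.2 ⟨key ha hb, ?_⟩
  rw [abs_sub_comm]
  exact key hb ha

@[simp]
theorem reflPt_apply_zero (x : Plane) : reflPt x 0 = -(x 0) := rfl

@[simp]
theorem reflPt_apply_one (x : Plane) : reflPt x 1 = x 1 := rfl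

theorem norm_sq_plane (x : Plane) : ‖x‖ ^ 2 = x 0 ^ 2 + x 1 ^ 2 := by
  simp [EuclideanSpace.norm_sq_eq, Fin.sum_univ_two]

theorem norm_reflPt_sub_reflPt (x y : Plane) : ‖reflPt x - reflPt y‖ = ‖x - y‖ := by
  rw [← sq_eq_sq₀ (norm_nonneg _) (norm_nonneg _), norm_sq_plane, norm_sq_plane]
  simp
  ring

theorem norm_sub_reflPt (x y : Plane) : ‖x - reflPt y‖ = ‖reflPt x - y‖ := by
  rw [← sq_eq_sq₀ (norm_nonneg _) (norm_nonneg _), norm_sq_plane, norm_sq_plane]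
  simp
  ring

@[fun_prop]
theorem continuous_reflPt : Continuous reflPt := by
  refine Isometry.continuous (Isometry.of_dist_eq fun x y => ?_)
  rw [dist_eq_norm, dist_eq_norm, norm_reflPt_sub_reflPt]

/-- The inversion `v / |v|²` of a vector, which is the gradient of `ln |v|`. -/
def invVec (v : Plane) : Plane := (‖v‖ ^ 2)⁻¹ • v

theorem norm_invVec (v : Plane) : ‖invVec v‖ = ‖v‖⁻¹ := by
  rcases eq_or_ne v 0 with rfl | hv
  · simp [invVec]
  · have := norm_ne_zero_iff.2 hv
    rw [invVec, norm_smul, norm_inv, norm_pow, norm_norm]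
    field_simp

theorem norm_invVec_sub {u v : Plane} (hu : u ≠ 0) (hv : v ≠ 0) :
    ‖invVec u - invVec v‖ = ‖u - v‖ / (‖u‖ * ‖v‖) := by
  have h := EuclideanGeometry.dist_inversion_inversion hu hv 1
  simp only [EuclideanGeometry.inversion, dist_eq_norm, vsub_eq_sub, sub_zero, vadd_eq_add,
    add_zero, one_div, inv_pow] at h
  rw [invVec, invVec, h]
  ring

theorem continuousOn_invVec : ContinuousOn invVec {0}ᶜ := by
  refine ContinuousOn.smul (ContinuousOn.inv₀ (f := fun v : Plane => ‖v‖ ^ 2) (by fun_prop)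
    fun v hv => ?_) continuousOn_id
  exact pow_ne_zero _ (norm_ne_zero_iff.2 hv)

theorem hasGradientAt_log_norm_sub {a y : Plane} (h : y ≠ a) :
    HasGradientAt (fun y => Real.log ‖y - a‖) (invVec (y - a)) y := by
  have hn : ‖y - a‖ ^ 2 ≠ 0 := pow_ne_zero _ (norm_ne_zero_iff.2 (sub_ne_zero.2 h))
  have hlog : (fun y : Plane => Real.log ‖y - a‖) =
      fun y => 1 / 2 * Real.log (‖y - a‖ ^ 2) := by
    ext y
    rw [Real.log_pow]
    ring
  have hderiv := ((((hasFDerivAt_id y).sub_const a).norm_sq).log hn).const_mul (1 / 2)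
  rw [hasGradientAt_iff_hasFDerivAt, hlog]
  refine hderiv.congr_fderiv (ContinuousLinearMap.ext fun v => ?_)
  simp [invVec]
  ring

/-- The logarithmic kernel `ln (|y - x̄| / |y - x|)` of the half plane. -/
def logKernel (y x : Plane) : ℝ := Real.log (‖y - reflPt x‖ / ‖y - x‖)

/-- The gradient in `y` of `logKernel y x`. -/
def logKernelGrad (y x : Plane) : Plane := invVec (y - reflPt x) - invVec (y - x)

theorem logKernel_eq {y x : Plane} (h₁ : y ≠ reflPt x) (h₂ : y ≠ x) :
    logKernel y x = Real.log ‖y - reflPt x‖ - Real.log ‖y - x‖ :=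
  Real.log_div (norm_ne_zero_iff.2 (sub_ne_zero.2 h₁)) (norm_ne_zero_iff.2 (sub_ne_zero.2 h₂))

theorem hasGradientAt_logKernel {y x : Plane} (h₁ : y ≠ reflPt x) (h₂ : y ≠ x) :
    HasGradientAt (fun y => logKernel y x) (logKernelGrad y x) y := by
  have h := (hasGradientAt_log_norm_sub h₁).hasFDerivAt.sub
    (hasGradientAt_log_norm_sub h₂).hasFDerivAt
  rw [← map_sub] at h
  refine HasFDerivAt.congr_of_eventuallyEq (h : HasFDerivAt _ _ y) ?_
  filter_upwards [isOpen_ne.mem_nhds h₁, isOpen_ne.mem_nhds h₂] with w hw₁ hw₂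
  exact logKernel_eq hw₁ hw₂

theorem continuousOn_logKernel {y : Plane} {s : Set Plane}
    (hs : ∀ x ∈ s, y ≠ reflPt x ∧ y ≠ x) : ContinuousOn (logKernel y) s := by
  refine ContinuousOn.log (ContinuousOn.div (by fun_prop) (by fun_prop) fun x hx => ?_)
    fun x hx => div_ne_zero ?_ ?_
  · exact norm_ne_zero_iff.2 (sub_ne_zero.2 (hs x hx).2)
  · exact norm_ne_zero_iff.2 (sub_ne_zero.2 (hs x hx).1)
  · exact norm_ne_zero_iff.2 (sub_ne_zero.2 (hs x hx).2)

theorem continuousOn_logKernelGrad {y : Plane} {s : Set Plane}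
    (hs : ∀ x ∈ s, y ≠ reflPt x ∧ y ≠ x) : ContinuousOn (logKernelGrad y) s :=
  (continuousOn_invVec.comp (by fun_prop) fun x hx => sub_ne_zero.2 (hs x hx).1).sub
    (continuousOn_invVec.comp (by fun_prop) fun x hx => sub_ne_zero.2 (hs x hx).2)

theorem integrableOn_of_subset_closedBall {E : Type*} [NormedAddCommGroup E] {f : Plane → E}
    {z : Plane} {ρ : ℝ} {s : Set Plane} (hf : ContinuousOn f (Metric.closedBall z ρ))
    (hs : s ⊆ Metric.closedBall z ρ) : IntegrableOn f s :=
  (hf.integrableOn_compact (isCompact_closedBall z ρ)).mono_set hs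

theorem ne_of_le_norm_sub {y x : Plane} {η : ℝ} (hη : 0 < η) (h : η ≤ ‖y - x‖) : y ≠ x :=
  sub_ne_zero.1 (norm_pos_iff.1 (hη.trans_le h))

theorem hasGradientAt_setIntegral_logKernel {x z : Plane} {ρ η : ℝ} {s : Set Plane}
    (hs : MeasurableSet s) (hsz : s ⊆ Metric.closedBall z ρ) (hη : 0 < η)
    (hx : ∀ w ∈ Metric.closedBall z ρ, η ≤ ‖x - reflPt w‖ ∧ η ≤ ‖x - w‖) :
    HasGradientAt (fun y => ∫ w in s, logKernel y w) (∫ w in s, logKernelGrad x w) x := by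
  have hη2 : 0 < η / 2 := half_pos hη
  have hnear (y : Plane) (hy : y ∈ Metric.ball x (η / 2)) (w : Plane)
      (hw : w ∈ Metric.closedBall z ρ) : η / 2 ≤ ‖y - reflPt w‖ ∧ η / 2 ≤ ‖y - w‖ := by
    rw [mem_ball_iff_norm'] at hy
    have h₁ := norm_sub_le_norm_sub_add_norm_sub x y (reflPt w)
    have h₂ := norm_sub_le_norm_sub_add_norm_sub x y w
    have := hx w hw
    constructor <;> linarith
  have hne (y : Plane) (hy : y ∈ Metric.ball x (η / 2)) (w : Plane)
      (hw : w ∈ Metric.closedBall z ρ) : y ≠ reflPt w ∧ y ≠ w :=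
    ⟨ne_of_le_norm_sub hη2 (hnear y hy w hw).1, ne_of_le_norm_sub hη2 (hnear y hy w hw).2⟩
  have hxmem : x ∈ Metric.ball x (η / 2) := Metric.mem_ball_self hη2
  have hgint : IntegrableOn (logKernelGrad x) s :=
    integrableOn_of_subset_closedBall (continuousOn_logKernelGrad (hne x hxmem)) hsz
  have hFint : IntegrableOn (fun w => InnerProductSpace.toDual ℝ Plane (logKernelGrad x w)) s :=
    integrableOn_of_subset_closedBall ((InnerProductSpace.toDual ℝ Plane).continuous.comp_continuousOn
      (continuousOn_logKernelGrad (hne x hxmem))) hsz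
  have hfin : volume s ≠ ⊤ :=
    ((measure_mono hsz).trans_lt measure_closedBall_lt_top).ne
  have hmain := hasFDerivAt_integral_of_dominated_of_fderiv_le (𝕜 := ℝ) (μ := volume.restrict s)
    (F := logKernel) (F' := fun y w => InnerProductSpace.toDual ℝ Plane (logKernelGrad y w))
    (bound := fun _ => (η / 2)⁻¹ + (η / 2)⁻¹) (Metric.ball_mem_nhds x hη2)
    (by
      filter_upwards [Metric.ball_mem_nhds x hη2] with y hy
      exact (integrableOn_of_subset_closedBall (continuousOn_logKernel (hne y hy))
        hsz).aestronglyMeasurable)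
    (integrableOn_of_subset_closedBall (continuousOn_logKernel (hne x hxmem)) hsz)
    hFint.aestronglyMeasurable
    (by
      filter_upwards [ae_restrict_mem hs] with w hw y hy
      have h := hnear y hy w (hsz hw)
      rw [LinearIsometryEquiv.norm_map]
      refine (norm_sub_le _ _).trans ?_
      rw [norm_invVec, norm_invVec]
      gcongr
      exacts [h.1, h.2])
    (integrableOn_const hfin)
    (by
      filter_upwards [ae_restrict_mem hs] with w hw y hy
      have h := hne y hy w (hsz hw)
      exact (hasGradientAt_logKernel h.1 h.2).hasFDerivAt)
  rw [hasGradientAt_iff_hasFDerivAt]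
  refine hmain.congr_fderiv (ContinuousLinearMap.ext fun v => ?_)
  rw [ContinuousLinearMap.integral_apply hFint]
  simp only [InnerProductSpace.toDual_apply_apply]
  rw [real_inner_comm, ← integral_inner hgint]
  simp only [real_inner_comm]

theorem setIntegral_ball_logKernel {y z : Plane} {r : ℝ} (hr : 0 ≤ r)
    (h₁ : r < ‖y - reflPt z‖) (h₂ : r < ‖y - z‖) :
    ∫ w in Metric.ball z r, logKernel y w = π * r ^ 2 * logKernel y z := by
  have hne {y w : Plane} (h : r < ‖y - z‖) (hw : w ∈ Metric.closedBall z r) : y ≠ w := by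
    rintro rfl
    rw [mem_closedBall_iff_norm] at hw
    linarith
  have hint {y : Plane} (h : r < ‖y - z‖) :
      IntegrableOn (fun w => Real.log ‖y - w‖) (Metric.ball z r) := by
    refine integrableOn_of_subset_closedBall (ContinuousOn.log (by fun_prop) fun w hw => ?_)
      Metric.ball_subset_closedBall
    exact norm_ne_zero_iff.2 (sub_ne_zero.2 (hne h hw))
  have hz (w : Plane) (hrw : r < ‖reflPt y - z‖) (hw : w ∈ Metric.closedBall z r) :
      y ≠ reflPt w := by
    have := hne hrw hw
    rwa [← sub_ne_zero, ← norm_ne_zero_iff, ← norm_sub_reflPt, norm_ne_zero_iff,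
      sub_ne_zero] at this
  rw [norm_sub_reflPt] at h₁
  have hzmem : z ∈ Metric.closedBall z r := Metric.mem_closedBall_self hr
  calc ∫ w in Metric.ball z r, logKernel y w
      = ∫ w in Metric.ball z r, (Real.log ‖reflPt y - w‖ - Real.log ‖y - w‖) := by
        refine setIntegral_congr_fun measurableSet_ball fun w hw => ?_
        have hw' := Metric.ball_subset_closedBall hw
        rw [logKernel_eq (hz w h₁ hw') (hne h₂ hw'), norm_sub_reflPt]
    _ = π * r ^ 2 * logKernel y z := by
        rw [integral_sub (hint h₁) (hint h₂), setIntegral_ball_log_norm_sub hr h₁,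
          setIntegral_ball_log_norm_sub hr h₂, logKernel_eq (hz z h₁ hzmem) (hne h₂ hzmem),
          norm_sub_reflPt]
        ring

theorem setIntegral_ball_logKernelGrad {x z : Plane} {r η : ℝ} (hr : 0 ≤ r) (hη : 0 < η)
    (hx : ∀ w ∈ Metric.closedBall z r, η ≤ ‖x - reflPt w‖ ∧ η ≤ ‖x - w‖)
    (h₁ : r < ‖x - reflPt z‖) (h₂ : r < ‖x - z‖) :
    ∫ w in Metric.ball z r, logKernelGrad x w = (π * r ^ 2) • logKernelGrad x z := by
  have hz := hx z (Metric.mem_closedBall_self hr)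
  have hleft := hasGradientAt_setIntegral_logKernel measurableSet_ball
    Metric.ball_subset_closedBall hη hx
  have hright := (hasGradientAt_logKernel (ne_of_le_norm_sub hη hz.1)
    (ne_of_le_norm_sub hη hz.2)).hasFDerivAt.const_mul (π * r ^ 2)
  have hsmul : (π * r ^ 2) • InnerProductSpace.toDual ℝ Plane (logKernelGrad x z) =
      InnerProductSpace.toDual ℝ Plane ((π * r ^ 2) • logKernelGrad x z) := by simp
  rw [hsmul] at hright
  refine HasGradientAt.unique hleft (HasFDerivAt.congr_of_eventuallyEq hright ?_)
  have hc (a : Plane) : Continuous fun y : Plane => ‖y - a‖ := by fun_prop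
  filter_upwards [(hc _).continuousAt.eventually_const_lt h₁,
    (hc _).continuousAt.eventually_const_lt h₂] with y hy₁ hy₂
  exact setIntegral_ball_logKernel hr hy₁ hy₂

theorem setIntegral_ball_apply_zero (z : Plane) {r : ℝ} (hr : 0 ≤ r) :
    ∫ w in Metric.ball z r, w 0 = π * r ^ 2 * z 0 := by
  have hcoord : Continuous fun w : Plane => w 0 := by fun_prop
  have hodd : ∫ w in Metric.ball (0 : Plane) r, w 0 = 0 := by
    have h := (Measure.measurePreserving_neg (volume : Measure Plane)).setIntegral_preimage_emb
      (Homeomorph.neg Plane).measurableEmbedding (fun w => w 0) (Metric.ball 0 r)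
    have hball : (Neg.neg : Plane → Plane) ⁻¹' Metric.ball 0 r = Metric.ball 0 r := by
      ext w
      simp
    rw [hball] at h
    simp only [PiLp.neg_apply, integral_neg] at h
    linarith
  have htrans := (measurePreserving_add_left (volume : Measure Plane) z).setIntegral_preimage_emb
      (Homeomorph.addLeft z).measurableEmbedding (fun w => w 0) (Metric.ball z r)
  have hball : (fun w => z + w) ⁻¹' Metric.ball z r = Metric.ball (0 : Plane) r := by
    ext w
    simp
  rw [← htrans, hball]
  simp only [PiLp.add_apply]
  rw [integral_add (integrableOn_const (C := z 0) measure_ball_lt_top.ne).integrable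
    (integrableOn_of_subset_closedBall hcoord.continuousOn Metric.ball_subset_closedBall), hodd,
    setIntegral_const, volume_real_ball_plane 0 hr, smul_eq_mul, add_zero]

theorem norm_setIntegral_sub_smul_le {E : Type*} [NormedAddCommGroup E] [NormedSpace ℝ E]
    [CompleteSpace E] {F : Plane → E} {z : Plane} {ρ r M : ℝ} {A : Set Plane} (hz : z 0 ≠ 0)
    (hr : 0 ≤ r) (hrρ : r ≤ ρ) (hA : MeasurableSet A) (hAz : A ⊆ Metric.closedBall z ρ)
    (hF : ContinuousOn F (Metric.closedBall z ρ))
    (hmean : ∫ w in Metric.ball z r, F w = (π * r ^ 2) • F z)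
    (hcirc : ∫ w in A, w 0 = π * r ^ 2 * z 0)
    (hM : ∀ w ∈ Metric.closedBall z ρ, ‖F w - (w 0 / z 0) • F z‖ ≤ M) :
    ‖(∫ w in A, F w) - (π * r ^ 2) • F z‖ ≤ M * volume.real (symmDiff A (Metric.ball z r)) := by
  have hBz : Metric.ball z r ⊆ Metric.closedBall z ρ :=
    (Metric.ball_subset_ball hrρ).trans Metric.ball_subset_closedBall
  have hlin : Continuous fun w : Plane => (w 0 / z 0) • F z := by fun_prop
  have hcont : ContinuousOn (fun w => F w - (w 0 / z 0) • F z) (Metric.closedBall z ρ) :=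
    hF.sub hlin.continuousOn
  have hfin {s : Set Plane} (hs : s ⊆ Metric.closedBall z ρ) : volume s ≠ ⊤ :=
    ((measure_mono hs).trans_lt measure_closedBall_lt_top).ne
  have hint {s : Set Plane} (hs : s ⊆ Metric.closedBall z ρ) (hI : ∫ w in s, w 0 = π * r ^ 2 * z 0) :
      ∫ w in s, (F w - (w 0 / z 0) • F z) = (∫ w in s, F w) - (π * r ^ 2) • F z := by
    rw [integral_sub (integrableOn_of_subset_closedBall hF hs)
      (integrableOn_of_subset_closedBall hlin.continuousOn hs), integral_smul_const,
      integral_div, hI, mul_div_cancel_right₀ _ hz]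
  have h := norm_setIntegral_sub_setIntegral_le hA measurableSet_ball (hfin hAz) (hfin hBz)
    (integrableOn_of_subset_closedBall hcont hAz) (integrableOn_of_subset_closedBall hcont hBz)
    fun w hw => hM w (Set.union_subset hAz hBz hw)
  rwa [hint hAz hcirc, hint hBz (setIntegral_ball_apply_zero z hr), hmean, sub_self,
    sub_zero] at h

theorem norm_sub_le_norm_sub_reflPt {x z : Plane} (hx : 0 < x 0) (hz : 0 < z 0) :
    ‖x - z‖ ≤ ‖x - reflPt z‖ := by
  rw [← sq_le_sq₀ (norm_nonneg _) (norm_nonneg _), norm_sq_plane, norm_sq_plane]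
  simp only [PiLp.sub_apply, reflPt_apply_zero, reflPt_apply_one]
  nlinarith

theorem norm_sub_reflPt_self {z : Plane} (hz : 0 < z 0) : ‖z - reflPt z‖ = 2 * z 0 := by
  rw [← sq_eq_sq₀ (norm_nonneg _) (by positivity), norm_sq_plane]
  simp
  ring

theorem abs_apply_zero_sub_le (w z : Plane) : |w 0 - z 0| ≤ ‖w - z‖ :=
  PiLp.norm_apply_le (w - z) 0

theorem half_le_norm_sub {x z w : Plane} {ρ : ℝ} (hx : 0 < x 0) (hz : 0 < z 0)
    (hd : 2 * ρ ≤ ‖x - z‖) (hw : w ∈ Metric.closedBall z ρ) :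
    ‖x - z‖ / 2 ≤ ‖x - reflPt w‖ ∧ ‖x - z‖ / 2 ≤ ‖x - w‖ := by
  rw [mem_closedBall_iff_norm] at hw
  have h₁ := norm_sub_le_norm_sub_add_norm_sub x (reflPt w) (reflPt z)
  have h₂ := norm_sub_le_norm_sub_add_norm_sub x w z
  rw [norm_reflPt_sub_reflPt] at h₁
  have := norm_sub_le_norm_sub_reflPt hx hz
  constructor <;> linarith

theorem norm_logKernel_sub_le {x z w : Plane} {ρ : ℝ} (hx : 0 < x 0) (hz : 0 < z 0) (hρ : 0 < ρ)
    (hd : 2 * ρ ≤ ‖x - z‖) (hw : w ∈ Metric.closedBall z ρ) :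
    ‖logKernel x w - (w 0 / z 0) • logKernel x z‖ ≤ 6 * ρ / ‖x - z‖ := by
  have hd0 : 0 < ‖x - z‖ := by linarith
  have hd2 : 0 < ‖x - z‖ / 2 := half_pos hd0
  obtain ⟨hw₁, hw₂⟩ := half_le_norm_sub hx hz hd hw
  have hrefl := norm_sub_le_norm_sub_reflPt hx hz
  rw [mem_closedBall_iff_norm] at hw
  have h₁ : |Real.log ‖x - reflPt w‖ - Real.log ‖x - reflPt z‖| ≤ ρ / (‖x - z‖ / 2) := by
    refine (abs_log_sub_log_le hd2 hw₁ (by linarith)).trans ?_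
    gcongr
    refine (abs_norm_sub_norm_le _ _).trans ?_
    rwa [sub_sub_sub_cancel_left, norm_reflPt_sub_reflPt, norm_sub_rev]
  have h₂ : |Real.log ‖x - w‖ - Real.log ‖x - z‖| ≤ ρ / (‖x - z‖ / 2) := by
    refine (abs_log_sub_log_le hd2 hw₂ (by linarith)).trans ?_
    gcongr
    refine (abs_norm_sub_norm_le _ _).trans ?_
    rwa [sub_sub_sub_cancel_left, norm_sub_rev]
  have h₃ : |Real.log ‖x - reflPt z‖ - Real.log ‖x - z‖| ≤ 2 * z 0 / ‖x - z‖ := by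
    refine (abs_log_sub_log_le hd0 hrefl le_rfl).trans ?_
    gcongr
    refine (abs_norm_sub_norm_le _ _).trans ?_
    rw [sub_sub_sub_cancel_left, norm_sub_reflPt_self hz]
  have h₄ : |(w 0 - z 0) / z 0| ≤ ρ / z 0 := by
    rw [abs_div, abs_of_pos hz]
    gcongr
    exact (abs_apply_zero_sub_le w z).trans hw
  rw [logKernel_eq (ne_of_le_norm_sub hd2 hw₁) (ne_of_le_norm_sub hd2 hw₂),
    logKernel_eq (ne_of_le_norm_sub hd0 hrefl) (ne_of_le_norm_sub hd0 le_rfl), Real.norm_eq_abs,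
    smul_eq_mul]
  set a := Real.log ‖x - reflPt w‖
  set b := Real.log ‖x - w‖
  set a' := Real.log ‖x - reflPt z‖
  set b' := Real.log ‖x - z‖
  calc |a - b - w 0 / z 0 * (a' - b')|
      = |(a - a') - (b - b') - (w 0 - z 0) / z 0 * (a' - b')| := by
        congr 1
        field_simp
        ring
    _ ≤ |a - a'| + |b - b'| + |(w 0 - z 0) / z 0| * |a' - b'| := by
        rw [← abs_mul]
        exact (abs_sub _ _).trans (add_le_add_left (abs_sub _ _) _)
    _ ≤ ρ / (‖x - z‖ / 2) + ρ / (‖x - z‖ / 2) + ρ / z 0 * (2 * z 0 / ‖x - z‖) := by gcongr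
    _ = 6 * ρ / ‖x - z‖ := by
        field_simp
        ring

theorem norm_logKernelGrad_sub_le {x z w : Plane} {ρ : ℝ} (hx : 0 < x 0) (hz : 0 < z 0)
    (hρ : 0 < ρ) (hd : 2 * ρ ≤ ‖x - z‖) (hw : w ∈ Metric.closedBall z ρ) :
    ‖logKernelGrad x w - (w 0 / z 0) • logKernelGrad x z‖ ≤ 6 * ρ / ‖x - z‖ ^ 2 := by
  have hd0 : 0 < ‖x - z‖ := by linarith
  have hd2 : 0 < ‖x - z‖ / 2 := half_pos hd0
  obtain ⟨hw₁, hw₂⟩ := half_le_norm_sub hx hz hd hw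
  have hrefl := norm_sub_le_norm_sub_reflPt hx hz
  rw [mem_closedBall_iff_norm] at hw
  have hne {a b : Plane} {η : ℝ} (hη : 0 < η) (h : η ≤ ‖a - b‖) : a - b ≠ 0 :=
    sub_ne_zero.2 (ne_of_le_norm_sub hη h)
  have h₁ : ‖invVec (x - reflPt w) - invVec (x - reflPt z)‖ ≤ ρ / (‖x - z‖ / 2 * ‖x - z‖) := by
    rw [norm_invVec_sub (hne hd2 hw₁) (hne hd0 hrefl), sub_sub_sub_cancel_left,
      norm_reflPt_sub_reflPt, norm_sub_rev]
    gcongr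
  have h₂ : ‖invVec (x - w) - invVec (x - z)‖ ≤ ρ / (‖x - z‖ / 2 * ‖x - z‖) := by
    rw [norm_invVec_sub (hne hd2 hw₂) (hne hd0 le_rfl), sub_sub_sub_cancel_left, norm_sub_rev]
    gcongr
  have h₃ : ‖invVec (x - reflPt z) - invVec (x - z)‖ ≤ 2 * z 0 / (‖x - z‖ * ‖x - z‖) := by
    rw [norm_invVec_sub (hne hd0 hrefl) (hne hd0 le_rfl), sub_sub_sub_cancel_left,
      norm_sub_reflPt_self hz]
    gcongr
  have h₄ : ‖(w 0 - z 0) / z 0‖ ≤ ρ / z 0 := by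
    rw [Real.norm_eq_abs, abs_div, abs_of_pos hz]
    gcongr
    exact (abs_apply_zero_sub_le w z).trans hw
  have hcoef : w 0 / z 0 = 1 + (w 0 - z 0) / z 0 := by
    field_simp
    ring
  simp only [logKernelGrad]
  set a := invVec (x - reflPt w)
  set b := invVec (x - w)
  set a' := invVec (x - reflPt z)
  set b' := invVec (x - z)
  calc ‖a - b - (w 0 / z 0) • (a' - b')‖
      = ‖(a - a') - (b - b') - ((w 0 - z 0) / z 0) • (a' - b')‖ := by
        rw [hcoef]
        congr 1
        module
    _ ≤ ‖a - a'‖ + ‖b - b'‖ + ‖(w 0 - z 0) / z 0‖ * ‖a' - b'‖ := by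
        rw [← norm_smul]
        exact (norm_sub_le _ _).trans (add_le_add_left (norm_sub_le _ _) _)
    _ ≤ ρ / (‖x - z‖ / 2 * ‖x - z‖) + ρ / (‖x - z‖ / 2 * ‖x - z‖) +
          ρ / z 0 * (2 * z 0 / (‖x - z‖ * ‖x - z‖)) := by gcongr
    _ = 6 * ρ / ‖x - z‖ ^ 2 := by
        field_simp
        ring

/-- **Far-field expansion with symmetric-difference error** (cf. Lemma C.2). If
`A ⊆ B_{Rε}(z)` has circulation `κ ∈ [κ₁, κ₀]` and differs from the disc `B_{s₀}(z)`,
`s₀ = ε√(κ/(πz₁))`, by measure `e`, then away from `z` (at distance `≥ Lε`) the potential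
`ψ₁` equals `(κz₁/2π) ln(|x−z̄|/|x−z|)` up to `O(e/(ε|x−z|))`, with the corresponding
gradient estimate. -/
theorem far_field_expansion_symmDiff (δ₀ κ₁ κ₀ R : ℝ)
    (hδ₀ : 0 < δ₀) (hκ₁ : 0 < κ₁) (hκ : κ₁ ≤ κ₀) (hR : 0 < R) :
    ∃ C > (0 : ℝ), ∃ ε₀ > (0 : ℝ), ∀ ε ∈ Set.Ioc (0 : ℝ) ε₀,
      ∀ z₁ : ℝ, δ₀ ≤ z₁ → z₁ ≤ 1 / δ₀ →
      ∀ A : Set Plane, MeasurableSet A → A ⊆ Metric.ball (mk2 z₁ 0) (R * ε) →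
      ∀ κ : ℝ, κ = (∫ x in A, x 0) / ε ^ 2 → κ₁ ≤ κ → κ ≤ κ₀ →
      ∀ s₀ : ℝ, s₀ = ε * Real.sqrt (κ / (π * z₁)) →
      ∀ e : ℝ, e = (volume (symmDiff A (Metric.ball (mk2 z₁ 0) s₀))).toReal →
      ∀ ψ₁ : Plane → ℝ,
        ψ₁ = (fun y =>
          z₁ ^ 2 / (2 * π * ε ^ 2) * ∫ x' in A, Real.log (‖y - reflPt x'‖ / ‖y - x'‖)) →
      ∀ x ∈ halfPlane,
        2 * (R + Real.sqrt (κ₀ / (π * δ₀)) + 1) * ε ≤ ‖x - mk2 z₁ 0‖ →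
        (|ψ₁ x - κ * z₁ / (2 * π) *
              Real.log (‖x - reflPt (mk2 z₁ 0)‖ / ‖x - mk2 z₁ 0‖)|
            ≤ C * e / (ε * ‖x - mk2 z₁ 0‖)) ∧
        DifferentiableAt ℝ ψ₁ x ∧
        ‖gradient ψ₁ x + (κ * z₁ / (2 * π)) •
            ((‖x - mk2 z₁ 0‖ ^ 2)⁻¹ • (x - mk2 z₁ 0)
              - (‖x - reflPt (mk2 z₁ 0)‖ ^ 2)⁻¹ • (x - reflPt (mk2 z₁ 0)))‖
          ≤ C * e / (ε * ‖x - mk2 z₁ 0‖ ^ 2) := by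
  set Λ : ℝ := R + Real.sqrt (κ₀ / (π * δ₀)) + 1
  have hΛ0 : 0 < Λ := by positivity
  refine ⟨3 * Λ / (π * δ₀ ^ 2), by positivity, 1, one_pos, ?_⟩
  rintro ε ⟨hε, -⟩ z₁ hz₁ hz₁' A hA hAz κ hκA hκ₁κ hκκ₀ s₀ hs₀ e he ψ₁ hψ₁ x hx hd
  set z := mk2 z₁ 0
  have hz : z 0 = z₁ := rfl
  have hz₁0 : 0 < z₁ := hδ₀.trans_le hz₁
  have hz0 : 0 < z 0 := hz₁0
  have hκ0 : 0 < κ := hκ₁.trans_le hκ₁κ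
  have hx0 : 0 < x 0 := hx
  have hρ : 0 < Λ * ε := by positivity
  have hd' : 2 * (Λ * ε) ≤ ‖x - z‖ := by linarith
  have hd0 : 0 < ‖x - z‖ := by linarith
  have hs₀0 : 0 ≤ s₀ := by rw [hs₀]; positivity
  have hs₀ρ : s₀ ≤ Λ * ε := by
    have hκ₀0 : 0 ≤ κ₀ := hκ0.le.trans hκκ₀
    have hsqrt : Real.sqrt (κ / (π * z₁)) ≤ Real.sqrt (κ₀ / (π * δ₀)) := by gcongr
    rw [hs₀, mul_comm]
    gcongr
    linarith
  have hAball : A ⊆ Metric.closedBall z (Λ * ε) := by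
    refine (hAz.trans (Metric.ball_subset_ball ?_)).trans Metric.ball_subset_closedBall
    gcongr
    linarith [Real.sqrt_nonneg (κ₀ / (π * δ₀))]
  have harea : π * s₀ ^ 2 = ε ^ 2 * κ / z₁ := by
    rw [hs₀, mul_pow, Real.sq_sqrt (by positivity)]
    field_simp
  have hcirc : ∫ w in A, w 0 = π * s₀ ^ 2 * z 0 := by
    rw [harea, hz, hκA]
    field_simp
  have hfar (w : Plane) (hw : w ∈ Metric.closedBall z (Λ * ε)) :=
    half_le_norm_sub hx0 hz0 hd' hw
  have hne (w : Plane) (hw : w ∈ Metric.closedBall z (Λ * ε)) : x ≠ reflPt w ∧ x ≠ w :=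
    ⟨ne_of_le_norm_sub (half_pos hd0) (hfar w hw).1, ne_of_le_norm_sub (half_pos hd0) (hfar w hw).2⟩
  have hs₀d : s₀ < ‖x - z‖ := by linarith
  have hs₀d' : s₀ < ‖x - reflPt z‖ := hs₀d.trans_le (norm_sub_le_norm_sub_reflPt hx0 hz0)
  have hval := norm_setIntegral_sub_smul_le hz0.ne' hs₀0 hs₀ρ hA hAball
    (continuousOn_logKernel hne) (setIntegral_ball_logKernel hs₀0 hs₀d' hs₀d) hcirc
    fun w hw => norm_logKernel_sub_le hx0 hz0 hρ hd' hw
  have hgrad := norm_setIntegral_sub_smul_le hz0.ne' hs₀0 hs₀ρ hA hAball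
    (continuousOn_logKernelGrad hne)
    (setIntegral_ball_logKernelGrad hs₀0 (half_pos hd0)
      (fun w hw => hfar w (Metric.closedBall_subset_closedBall hs₀ρ hw)) hs₀d' hs₀d) hcirc
    fun w hw => norm_logKernelGrad_sub_le hx0 hz0 hρ hd' hw
  rw [Measure.real, ← he] at hval hgrad
  set c := z₁ ^ 2 / (2 * π * ε ^ 2) with hc
  have hc0 : 0 ≤ c := by positivity
  have he0 : 0 ≤ e := he ▸ ENNReal.toReal_nonneg
  have hcoef : κ * z₁ / (2 * π) = c * (π * s₀ ^ 2) := by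
    rw [harea, hc]
    field_simp
  have hz₁sq : z₁ ^ 2 ≤ (1 / δ₀) ^ 2 := by gcongr
  have hconst (D : ℝ) (hD : 0 < D) :
      c * (6 * (Λ * ε) / D * e) ≤ 3 * Λ / (π * δ₀ ^ 2) * e / (ε * D) := by
    calc c * (6 * (Λ * ε) / D * e) = z₁ ^ 2 * (3 * Λ / π * e / (ε * D)) := by
          rw [hc]
          field_simp
          ring
      _ ≤ (1 / δ₀) ^ 2 * (3 * Λ / π * e / (ε * D)) := by gcongr
      _ = 3 * Λ / (π * δ₀ ^ 2) * e / (ε * D) := by field_simp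
  have hψ : HasGradientAt ψ₁ (c • ∫ w in A, logKernelGrad x w) x := by
    have h := (hasGradientAt_setIntegral_logKernel hA hAball (half_pos hd0)
      hfar).hasFDerivAt.const_mul c
    rw [hψ₁, hasGradientAt_iff_hasFDerivAt, map_smulₛₗ]
    exact h
  refine ⟨?_, hψ.differentiableAt, ?_⟩
  · have hdiff : ψ₁ x - κ * z₁ / (2 * π) * logKernel x z =
        c * ((∫ w in A, logKernel x w) - (π * s₀ ^ 2) • logKernel x z) := by
      rw [hcoef, hψ₁, smul_eq_mul, mul_sub, mul_assoc]
      rfl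
    change |ψ₁ x - κ * z₁ / (2 * π) * logKernel x z| ≤ _
    rw [hdiff, abs_mul, abs_of_nonneg hc0]
    exact (mul_le_mul_of_nonneg_left hval hc0).trans (hconst _ hd0)
  · have hdiff : gradient ψ₁ x + (κ * z₁ / (2 * π)) • (invVec (x - z) - invVec (x - reflPt z)) =
        c • ((∫ w in A, logKernelGrad x w) - (π * s₀ ^ 2) • logKernelGrad x z) := by
      rw [hcoef, hψ.gradient, mul_smul, ← smul_add, ← neg_sub (invVec (x - reflPt z)), smul_neg,
        ← sub_eq_add_neg, logKernelGrad]
    change ‖gradient ψ₁ x + (κ * z₁ / (2 * π)) • (invVec (x - z) - invVec (x - reflPt z))‖ ≤ _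
    rw [hdiff, norm_smul, Real.norm_of_nonneg hc0]
    exact (mul_le_mul_of_nonneg_left hgrad hc0).trans (hconst _ (by positivity))
end
end
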